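/- arXiv:1907.03215 — 8 statements merged into one kernel-verified Lean document; each statement's English description precedes it below -/
import Mathlib

section
/- For every r with 0 ≤ r ≤ 𝓡, the function q is twice differentiable at r and satisfies the contraction inequality q''(r) + α·r·q'(r) ≤ −(exp(−7α𝓡²/3)/(32𝓡²))·q(r). -/
open MeasureTheory Real

/-- The concave reweighting function τ from the Eberle-type construction. -/
noncomputable def tau (R r : ℝ) : ℝ :=
  if r ≤ R then r ^ 2 / 2
  else if r ≤ 2 * R then
    R ^ 2 / 2 + R * (r - R) + (r - R) ^ 2 / 2 - (r - R) ^ 3 / (3 * R)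
  else if r ≤ 4 * R then
    5 * R ^ 2 / 3 + R * (r - 2 * R) - (r - 2 * R) ^ 2 / 2 + (r - 2 * R) ^ 3 / (12 * R)
  else 7 * R ^ 2 / 3

/-- The cutoff function μ. -/
noncomputable def muf (R r : ℝ) : ℝ :=
  if r ≤ R then 1
  else if r ≤ 4 * R then 1 / 2 + 1 / 2 * Real.cos (Real.pi * (r - R) / (3 * R))
  else 0

/-- ψ(r) = exp(−α τ(r)). -/
noncomputable def psi (α R r : ℝ) : ℝ := Real.exp (-(α * tau R r))

/-- Ψ(r) = ∫₀ʳ ψ(s) ds. -/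
noncomputable def PsiInt (α R r : ℝ) : ℝ := ∫ s in (0:ℝ)..r, psi α R s

/-- ν(r) = 1 − (1/2) (∫₀ʳ μΨ/ψ) / (∫₀^{4R} μΨ/ψ). -/
noncomputable def nuf (α R r : ℝ) : ℝ :=
  1 - (1 / 2) * (∫ s in (0:ℝ)..r, muf R s * PsiInt α R s / psi α R s) /
      (∫ s in (0:ℝ)..(4 * R), muf R s * PsiInt α R s / psi α R s)

/-- q(r) = ∫₀ʳ ψ(s) ν(s) ds. -/
noncomputable def qf (α R r : ℝ) : ℝ := ∫ s in (0:ℝ)..r, psi α R s * nuf α R s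


lemma tau_cont (R : ℝ) (hR : 0 < R) : Continuous (tau R) := by
  unfold tau
  refine Continuous.if_le (by fun_prop) (Continuous.if_le (by fun_prop) (Continuous.if_le (by fun_prop)
    (by fun_prop) continuous_id continuous_const ?_) continuous_id continuous_const ?_)
    continuous_id continuous_const ?_
  · intro x hx
    subst hx
    field_simp
    ring
  · intro x hx
    subst hx
    rw [if_pos (by linarith)]
    field_simp
    ring
  · intro x hx
    subst hx
    rw [if_pos (by linarith)]
    simp

lemma muf_cont (R : ℝ) (hR : 0 < R) : Continuous (muf R) := by
  unfold muf
  refine Continuous.if_le (by fun_prop) (Continuous.if_le (by fun_prop)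
    (by fun_prop) continuous_id continuous_const ?_) 
    continuous_id continuous_const ?_
  · intro x hx
    subst hx
    have : π * (4 * R - R) / (3 * R) = π := by field_simp; ring
    rw [this, Real.cos_pi]; norm_num
  · intro x hx
    subst hx
    rw [if_pos (by linarith)]
    norm_num

lemma muf_mem (R r : ℝ) : 0 ≤ muf R r ∧ muf R r ≤ 1 := by
  unfold muf
  have h1 := Real.cos_le_one (π * (r - R) / (3 * R))
  have h2 := Real.neg_one_le_cos (π * (r - R) / (3 * R))
  split_ifs <;> constructor <;> linarith

lemma tau_mem (R r : ℝ) (hR : 0 < R) (h0 : 0 ≤ r) : 0 ≤ tau R r ∧ tau R r ≤ 7 * R ^ 2 / 3 := by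
  unfold tau
  split_ifs with h1 h2 h3
  · constructor
    · positivity
    · nlinarith
  · push Not at h1
    obtain ⟨t, rfl⟩ : ∃ t, r = R + t := ⟨r - R, by ring⟩
    have ht : 0 ≤ t := by linarith
    have ht' : t ≤ R := by linarith
    simp only [add_sub_cancel_left]
    have e1 : t ^ 3 / (3 * R) ≤ t ^ 2 / 3 := by
      rw [div_le_div_iff₀ (by positivity) (by positivity)]
      nlinarith [mul_le_mul_of_nonneg_left ht' (sq_nonneg t)]
    have e0 : 0 ≤ t ^ 3 / (3 * R) := by positivity
    constructor <;> nlinarith [mul_nonneg hR.le ht]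
  · push Not at h2
    obtain ⟨t, rfl⟩ : ∃ t, r = 2 * R + t := ⟨r - 2 * R, by ring⟩
    have ht : 0 ≤ t := by linarith
    have ht' : t ≤ 2 * R := by linarith
    simp only [add_sub_cancel_left]
    have e0 : 0 ≤ t ^ 3 / (12 * R) := by positivity
    have e1 : 0 ≤ (2 * R - t) ^ 3 / (12 * R) := by
      have : 0 ≤ 2 * R - t := by linarith
      positivity
    have e2 : (2 * R - t) ^ 3 / (12 * R) = 2 * R ^ 2 / 3 - R * t + t ^ 2 / 2 - t ^ 3 / (12 * R) := by
      field_simp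
      ring
    constructor
    · nlinarith [mul_nonneg ht (sub_nonneg.2 ht')]
    · linarith
  · constructor
    · positivity
    · exact le_rfl

lemma tau_deriv (R r : ℝ) (hR : 0 < R) (h : r ≤ R) : HasDerivAt (tau R) r r := by
  have key : HasDerivAt (fun x : ℝ => x ^ 2 / 2) r r := by
    have := ((hasDerivAt_id r).pow 2).div_const 2
    simpa using this
  rcases lt_or_eq_of_le h with h | rfl
  · refine key.congr_of_eventuallyEq ?_
    filter_upwards [Iio_mem_nhds h] with x hx
    simp [tau, le_of_lt (show x < R from hx)]
  · have h1 : HasDerivWithinAt (tau r) r (Set.Iic r) r :=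
      key.hasDerivWithinAt.congr (fun x hx => by simp [tau, show x ≤ r from hx]) (by simp [tau])
    have k2 : HasDerivAt (fun x : ℝ => r ^ 2 / 2 + r * (x - r) + (x - r) ^ 2 / 2
        - (x - r) ^ 3 / (3 * r)) r r := by
      have a := (hasDerivAt_id r).sub_const r
      have := (((a.const_mul r).const_add (r ^ 2 / 2)).add ((a.pow 2).div_const 2)).sub
        ((a.pow 3).div_const (3 * r))
      refine HasDerivAt.congr_deriv (f := fun x : ℝ => r ^ 2 / 2 + r * (x - r) + (x - r) ^ 2 / 2
        - (x - r) ^ 3 / (3 * r)) this ?_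
      simp
    have h2 : HasDerivWithinAt (tau r) r (Set.Ici r) r := by
      refine k2.hasDerivWithinAt.congr_of_eventuallyEq ?_ (by simp [tau])
      filter_upwards [self_mem_nhdsWithin,
        mem_nhdsWithin_of_mem_nhds (Iio_mem_nhds (show r < 2 * r by linarith))] with x hx hx2
      rcases eq_or_lt_of_le (show r ≤ x from hx) with rfl | hlt
      · simp [tau]
      · simp [tau, not_le.2 hlt, le_of_lt (show x < 2 * r from hx2)]
    have := h1.union h2
    rwa [Set.Iic_union_Ici, hasDerivWithinAt_univ] at this

theorem q_contraction (α R : ℝ) (hα : 0 < α) (hR : 0 < R) :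
    ∀ r : ℝ, 0 ≤ r → r ≤ R →
      DifferentiableAt ℝ (qf α R) r ∧
      DifferentiableAt ℝ (deriv (qf α R)) r ∧
      deriv (deriv (qf α R)) r + α * r * deriv (qf α R) r ≤
        -(Real.exp (-(7 * α * R ^ 2 / 3)) / (32 * R ^ 2)) * qf α R r := by
  intro r h0 hr
  have hψc : Continuous (psi α R) := by
    have := tau_cont R hR
    unfold psi; fun_prop
  have hψpos : ∀ s, 0 < psi α R s := fun s => Real.exp_pos _
  have hψd : ∀ s, HasDerivAt (PsiInt α R) (psi α R s) s := fun s =>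
    intervalIntegral.integral_hasDerivAt_right (hψc.intervalIntegrable _ _)
      (hψc.stronglyMeasurableAtFilter _ _) hψc.continuousAt
  have hΨc : Continuous (PsiInt α R) :=
    continuous_iff_continuousAt.2 fun s => (hψd s).continuousAt
  have hΨ0 : ∀ s, 0 ≤ s → 0 ≤ PsiInt α R s := fun s hs =>
    intervalIntegral.integral_nonneg hs fun u _ => (hψpos u).le
  have hΨs : ∀ s, 0 ≤ s → PsiInt α R s ≤ s := by
    intro s hs
    have : PsiInt α R s ≤ ∫ _ in (0:ℝ)..s, (1:ℝ) := by
      refine intervalIntegral.integral_mono_on hs (hψc.intervalIntegrable _ _) (by simp) ?_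
      intro x hx
      have := mul_nonneg hα.le (tau_mem R x hR hx.1).1
      exact Real.exp_le_one_iff.2 (by linarith)
    simpa using this
  set f : ℝ → ℝ := fun s => muf R s * PsiInt α R s / psi α R s with hf
  have hfc : Continuous f :=
    ((muf_cont R hR).mul hΨc).div hψc fun s => (hψpos s).ne'
  have hf0 : ∀ s, 0 ≤ s → 0 ≤ f s := fun s hs =>
    div_nonneg (mul_nonneg (muf_mem R s).1 (hΨ0 s hs)) (hψpos s).le
  set D : ℝ := ∫ s in (0:ℝ)..(4 * R), f s with hD
  have hDpos : 0 < D := by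
    refine intervalIntegral.integral_pos (by linarith) hfc.continuousOn
      (fun x hx => hf0 x hx.1.le) ⟨R, ⟨hR.le, by linarith⟩, ?_⟩
    refine div_pos (mul_pos (by simp [muf]) ?_) (hψpos R)
    exact intervalIntegral.intervalIntegral_pos_of_pos (hψc.intervalIntegrable _ _) hψpos hR
  set E : ℝ := Real.exp (7 * α * R ^ 2 / 3) with hE
  have hEpos : 0 < E := Real.exp_pos _
  have hDle : D ≤ 8 * R ^ 2 * E := by
    have h1 : D ≤ ∫ s in (0:ℝ)..(4 * R), s * E := by
      refine intervalIntegral.integral_mono_on (by linarith) (hfc.intervalIntegrable _ _)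
        ((by fun_prop : Continuous fun s : ℝ => s * E).intervalIntegrable _ _) ?_
      intro x hx
      have hx0 := hx.1
      have a1 : (psi α R x)⁻¹ ≤ E := by
        rw [psi, ← Real.exp_neg, hE]
        apply Real.exp_le_exp.2
        have := mul_le_mul_of_nonneg_left (tau_mem R x hR hx0).2 hα.le
        linarith
      have a2 : muf R x * PsiInt α R x ≤ x := by
        have := mul_le_mul (muf_mem R x).2 (hΨs x hx0) (hΨ0 x hx0) zero_le_one
        linarith
      simp only [hf, div_eq_mul_inv]
      exact mul_le_mul a2 a1 (inv_nonneg.2 (hψpos x).le) hx0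
    have h2 : (∫ s in (0:ℝ)..(4 * R), s * E) = 8 * R ^ 2 * E := by
      rw [intervalIntegral.integral_mul_const, integral_id]; ring
    linarith
  have hνd : ∀ s, HasDerivAt (nuf α R) (-((1 / 2) * f s / D)) s := by
    intro s
    have := intervalIntegral.integral_hasDerivAt_right (hfc.intervalIntegrable 0 s)
      (hfc.stronglyMeasurableAtFilter _ _) hfc.continuousAt
    exact ((this.const_mul (1 / 2)).div_const D).const_sub 1
  have hνc : Continuous (nuf α R) :=
    continuous_iff_continuousAt.2 fun s => (hνd s).continuousAt
  have hgc : Continuous fun s => psi α R s * nuf α R s := hψc.mul hνc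
  have hqd : ∀ s, HasDerivAt (qf α R) (psi α R s * nuf α R s) s := fun s =>
    intervalIntegral.integral_hasDerivAt_right (hgc.intervalIntegrable _ _)
      (hgc.stronglyMeasurableAtFilter _ _) hgc.continuousAt
  have hq' : deriv (qf α R) = fun s => psi α R s * nuf α R s := funext fun s => (hqd s).deriv
  have hψ' : HasDerivAt (psi α R) (psi α R r * -(α * r)) r :=
    ((tau_deriv R r hR hr).const_mul α).neg.exp
  have hq'' := hψ'.mul (hνd r)
  have hqle : qf α R r ≤ PsiInt α R r := by
    refine intervalIntegral.integral_mono_on h0 (hgc.intervalIntegrable _ _)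
      (hψc.intervalIntegrable _ _) ?_
    intro x hx
    have i0 : 0 ≤ ∫ s in (0:ℝ)..x, f s :=
      intervalIntegral.integral_nonneg hx.1 fun u hu => hf0 u hu.1
    have : nuf α R x ≤ 1 := by
      have : 0 ≤ (1 / 2) * (∫ s in (0:ℝ)..x, f s) / D := by positivity
      change 1 - (1 / 2) * (∫ s in (0:ℝ)..x, f s) / D ≤ 1
      linarith
    have := mul_le_mul_of_nonneg_left this (hψpos x).le
    linarith
  refine ⟨(hqd r).differentiableAt, ?_, ?_⟩
  · rw [hq']; exact hq''.differentiableAt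
  · rw [hq', show deriv (fun s => psi α R s * nuf α R s) r = _ from hq''.deriv]
    have hfr : psi α R r * f r = PsiInt α R r := by
      have := (hψpos r).ne'
      simp only [hf, muf, if_pos hr]
      field_simp
    have e1 : psi α R r * -(α * r) * nuf α R r + psi α R r * -((1 / 2) * f r / D)
        + α * r * (psi α R r * nuf α R r) = -(PsiInt α R r / (2 * D)) := by
      rw [← hfr]; field_simp; ring
    rw [e1, Real.exp_neg, ← hE]
    have hc : E⁻¹ / (32 * R ^ 2) ≤ 1 / (2 * D) := by
      have : E⁻¹ / (32 * R ^ 2) = 1 / (32 * R ^ 2 * E) := by field_simp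
      rw [this]
      apply one_div_le_one_div_of_le (by positivity)
      have : 0 < R ^ 2 * E := by positivity
      linarith
    have c0 : 0 ≤ E⁻¹ / (32 * R ^ 2) := by positivity
    have b1 := mul_le_mul_of_nonneg_left hqle c0
    have b2 := mul_le_mul_of_nonneg_right hc (hΨ0 r h0)
    have b3 : 1 / (2 * D) * PsiInt α R r = PsiInt α R r / (2 * D) := by ring
    linarith
end

section
/- The function q is differentiable on [0,∞) and its derivative satisfies (1/2)·exp(−7α𝓡²/3) ≤ q'(r) ≤ 1 for every r ≥ 0. -/
open MeasureTheory Real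

lemma muf_nonneg (R r : ℝ) : 0 ≤ muf R r := by
  unfold muf
  have := Real.neg_one_le_cos (Real.pi * (r - R) / (3 * R))
  split_ifs <;> linarith

lemma tau_bounds (R r : ℝ) (hR : 0 < R) (hr : 0 ≤ r) :
    0 ≤ tau R r ∧ tau R r ≤ 7 * R ^ 2 / 3 := by
  unfold tau
  split_ifs with h1 h2 h3
  · constructor
    · positivity
    · nlinarith
  · push Not at h1
    obtain ⟨x, rfl⟩ : ∃ x, r = R + x := ⟨r - R, by ring⟩
    have hx : 0 ≤ x := by linarith
    have hx2 : x ≤ R := by linarith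
    have e : R + x - R = x := by ring
    rw [e]
    have a : 0 ≤ x ^ 3 / (3 * R) := by positivity
    have b : x ^ 3 / (3 * R) ≤ x ^ 2 / 3 := by
      rw [div_le_iff₀ (by positivity)]
      nlinarith [mul_nonneg (sq_nonneg x) (sub_nonneg.2 hx2)]
    have c : x ^ 2 / 2 - x ^ 3 / (3 * R) ≤ R ^ 2 / 6 + (R * (R - x)) * 0 + R * (R - x) := by
      have : x ^ 3 / (3 * R) ≥ x ^ 2 / 3 - x * (R - x) / 3 := by
        rw [ge_iff_le, le_div_iff₀ (by positivity)]
        nlinarith [mul_nonneg hx (sq_nonneg (R - x))]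
      nlinarith
    constructor
    · nlinarith [mul_nonneg hR.le hx, sq_nonneg x, sq_nonneg R]
    · nlinarith [sq_nonneg R]
  · push Not at h1 h2
    obtain ⟨y, rfl⟩ : ∃ y, r = 4 * R - y := ⟨4 * R - r, by ring⟩
    have hy : 0 ≤ y := by linarith
    have hy2 : y ≤ 2 * R := by linarith
    have e : 5 * R ^ 2 / 3 + R * (4 * R - y - 2 * R) - (4 * R - y - 2 * R) ^ 2 / 2
        + (4 * R - y - 2 * R) ^ 3 / (12 * R) = 7 * R ^ 2 / 3 - y ^ 3 / (12 * R) := by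
      field_simp
      ring
    rw [e]
    have a : 0 ≤ y ^ 3 / (12 * R) := by positivity
    have b : y ^ 3 / (12 * R) ≤ R ^ 2 := by
      rw [div_le_iff₀ (by positivity)]
      have : y ^ 3 ≤ (2 * R) ^ 3 := by gcongr
      nlinarith [pow_pos hR 3]
    constructor <;> nlinarith [sq_nonneg R]
  · constructor
    · positivity
    · exact le_rfl

lemma psi_cont (α R : ℝ) (hR : 0 < R) : Continuous (psi α R) := by
  have := tau_cont R hR
  unfold psi
  fun_prop

lemma psi_pos (α R r : ℝ) : 0 < psi α R r := Real.exp_pos _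

lemma integrand_cont (α R : ℝ) (hR : 0 < R) :
    Continuous (fun s => muf R s * PsiInt α R s / psi α R s) := by
  have hp := psi_cont α R hR
  have hP : Continuous (PsiInt α R) :=
    intervalIntegral.continuous_primitive (fun a b => hp.intervalIntegrable a b) 0
  exact ((muf_cont R hR).mul hP).div hp (fun s => (psi_pos α R s).ne')

lemma integrand_nonneg (α R s : ℝ) (hs : 0 ≤ s) :
    0 ≤ muf R s * PsiInt α R s / psi α R s := by
  refine div_nonneg (mul_nonneg (muf_nonneg R s) ?_) (psi_pos α R s).le
  exact intervalIntegral.integral_nonneg hs (fun u _ => (psi_pos α R u).le)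

lemma nuf_cont (α R : ℝ) (hR : 0 < R) : Continuous (nuf α R) := by
  have hi := integrand_cont α R hR
  have h := intervalIntegral.continuous_primitive
    (fun a b => hi.intervalIntegrable (μ := volume) a b) 0
  unfold nuf
  exact continuous_const.sub ((continuous_const.mul h).div_const _)

lemma nuf_bounds (α R r : ℝ) (hR : 0 < R) (hr : 0 ≤ r) :
    1 / 2 ≤ nuf α R r ∧ nuf α R r ≤ 1 := by
  have hi := integrand_cont α R hR
  have hN : 0 ≤ ∫ s in (0:ℝ)..r, muf R s * PsiInt α R s / psi α R s :=
    intervalIntegral.integral_nonneg hr (fun u hu => integrand_nonneg α R u hu.1)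
  have hD : 0 ≤ ∫ s in (0:ℝ)..(4 * R), muf R s * PsiInt α R s / psi α R s :=
    intervalIntegral.integral_nonneg (by linarith) (fun u hu => integrand_nonneg α R u hu.1)
  have hle : (∫ s in (0:ℝ)..r, muf R s * PsiInt α R s / psi α R s) ≤
      ∫ s in (0:ℝ)..(4 * R), muf R s * PsiInt α R s / psi α R s := by
    rcases le_total r (4 * R) with h | h
    · rw [← intervalIntegral.integral_add_adjacent_intervals
        (hi.intervalIntegrable 0 r) (hi.intervalIntegrable r (4 * R))]
      have := intervalIntegral.integral_nonneg (μ := volume) h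
        (fun u hu => integrand_nonneg α R u (hr.trans hu.1))
      linarith
    · rw [← intervalIntegral.integral_add_adjacent_intervals
        (hi.intervalIntegrable 0 (4 * R)) (hi.intervalIntegrable (4 * R) r)]
      have : (∫ s in (4 * R)..r, muf R s * PsiInt α R s / psi α R s) = 0 := by
        apply intervalIntegral.integral_zero_ae
        refine Filter.Eventually.of_forall (fun x hx => ?_)
        rw [Set.uIoc_of_le h] at hx
        have h0 : muf R x = 0 := by
          unfold muf
          rw [if_neg (by linarith [hx.1]), if_neg (by linarith [hx.1])]
        simp [h0]
      linarith
  have h1 := div_le_one_of_le₀ hle hD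
  have h2 := div_nonneg hN hD
  unfold nuf
  rw [mul_div_assoc]
  constructor <;> linarith

theorem q_deriv_bounds (α R : ℝ) (hα : 0 < α) (hR : 0 < R) :
    ∀ r : ℝ, 0 ≤ r →
      DifferentiableAt ℝ (qf α R) r ∧
      1 / 2 * Real.exp (-(7 * α * R ^ 2 / 3)) ≤ deriv (qf α R) r ∧
      deriv (qf α R) r ≤ 1 := by
  intro r hr
  have hc : Continuous (fun s => psi α R s * nuf α R s) :=
    (psi_cont α R hR).mul (nuf_cont α R hR)
  have hd : HasDerivAt (qf α R) (psi α R r * nuf α R r) r :=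
    intervalIntegral.integral_hasDerivAt_right (hc.intervalIntegrable 0 r)
      hc.stronglyMeasurable.stronglyMeasurableAtFilter hc.continuousAt
  obtain ⟨n1, n2⟩ := nuf_bounds α R r hR hr
  obtain ⟨t1, t2⟩ := tau_bounds R r hR hr
  have p1 : Real.exp (-(7 * α * R ^ 2 / 3)) ≤ psi α R r := by
    unfold psi
    apply Real.exp_le_exp.2
    nlinarith [mul_le_mul_of_nonneg_left t2 hα.le]
  have p2 : psi α R r ≤ 1 := by
    unfold psi
    apply Real.exp_le_one_iff.2
    have := mul_nonneg hα.le t1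
    linarith
  have p0 := psi_pos α R r
  refine ⟨hd.differentiableAt, ?_, ?_⟩
  · rw [hd.deriv]
    nlinarith [mul_le_mul_of_nonneg_left n1 p0.le]
  · rw [hd.deriv]
    nlinarith [mul_le_mul_of_nonneg_left n2 p0.le]
end

section
/- For all x, y ∈ ℝ^d the noise covariance matrices satisfy: (1) tr(Σ(x)) ≤ β²; (2) tr((Σ(x) − Σ(y))²) ≤ 16·β²·L_ξ²·‖x − y‖₂²; and (3) tr((Σ(x) − Σ(y))²) ≤ 32·β³·L_ξ·‖x − y‖₂. -/
open MeasureTheory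

lemma ncr_pointwise {d : ℕ} (u v : EuclideanSpace ℝ (Fin d)) :
    ∑ i, ∑ j, (u i * u j - v i * v j) ^ 2 ≤ 2 * ‖u - v‖ ^ 2 * (‖u‖ ^ 2 + ‖v‖ ^ 2) := by
  have h : ∑ i, ∑ j, (u i * u j - v i * v j) ^ 2 ≤
      ∑ i, ∑ j, (2 * (u i ^ 2 * (u - v) j ^ 2) + 2 * ((u - v) i ^ 2 * v j ^ 2)) := by
    refine Finset.sum_le_sum fun i _ => Finset.sum_le_sum fun j _ => ?_
    simp only [PiLp.sub_apply]
    nlinarith [sq_nonneg (u i * (u j - v j) - (u i - v i) * v j)]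
  refine h.trans (le_of_eq ?_)
  simp only [EuclideanSpace.real_norm_sq_eq, Finset.sum_add_distrib, ← Finset.mul_sum,
    ← Finset.sum_mul]
  ring

theorem noise_covariance_regularity {d : ℕ} {Θ : Type*} [MeasurableSpace Θ]
    (P : Measure Θ) [IsProbabilityMeasure P]
    (ξ : EuclideanSpace ℝ (Fin d) → Θ → EuclideanSpace ℝ (Fin d))
    (hmeas : ∀ x, Measurable (ξ x))
    (β Lξ : ℝ) (hβ : 0 < β) (hLξ : 0 < Lξ)
    (hbound : ∀ x, ∀ᵐ θ ∂P, ‖ξ x θ‖ ≤ β)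
    (hlip : ∀ x y, ∀ᵐ θ ∂P, ‖ξ x θ - ξ y θ‖ ≤ Lξ * ‖x - y‖)
    (S : EuclideanSpace ℝ (Fin d) → Matrix (Fin d) (Fin d) ℝ)
    (hS : ∀ x i j, S x i j = ∫ θ, ξ x θ i * ξ x θ j ∂P)
    (hSpsd : ∀ x, (S x).PosSemidef) :
    ∀ x y : EuclideanSpace ℝ (Fin d),
      (S x).trace ≤ β ^ 2 ∧
      ((S x - S y) ^ 2).trace ≤ 16 * β ^ 2 * Lξ ^ 2 * ‖x - y‖ ^ 2 ∧
      ((S x - S y) ^ 2).trace ≤ 32 * β ^ 3 * Lξ * ‖x - y‖ := by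
  intro x y
  have hm : ∀ x i, Measurable fun θ => ξ x θ i := fun x i => by
    have := hmeas x
    fun_prop
  have hint : ∀ x i j, Integrable (fun θ => ξ x θ i * ξ x θ j) P := by
    intro x i j
    refine Integrable.of_bound ((hm x i).mul (hm x j)).aestronglyMeasurable (β * β) ?_
    filter_upwards [hbound x] with θ h
    rw [norm_mul]
    exact mul_le_mul ((PiLp.norm_apply_le _ i).trans h) ((PiLp.norm_apply_le _ j).trans h)
      (norm_nonneg _) hβ.le
  have hsym : ∀ x i j, S x i j = S x j i := fun x i j => by
    rw [hS, hS]; simp only [mul_comm]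
  have htr : ((S x - S y) ^ 2).trace = ∑ i, ∑ j, (S x i j - S y i j) ^ 2 := by
    simp only [Matrix.trace, Matrix.diag, pow_two, Matrix.mul_apply, Matrix.sub_apply]
    refine Finset.sum_congr rfl fun i _ => Finset.sum_congr rfl fun j _ => ?_
    rw [hsym x j i, hsym y j i]
  have key : ∀ C : ℝ, (∀ᵐ θ ∂P, ∑ i, ∑ j, (ξ x θ i * ξ x θ j - ξ y θ i * ξ y θ j) ^ 2 ≤ C) →
      ((S x - S y) ^ 2).trace ≤ C := by
    intro C hC
    rw [htr]
    set D : Fin d → Fin d → ℝ := fun i j => S x i j - S y i j with hD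
    set Q := ∑ i, ∑ j, (S x i j - S y i j) ^ 2 with hQ
    have hI : ∀ i j, Integrable
        (fun θ => D i j * (ξ x θ i * ξ x θ j - ξ y θ i * ξ y θ j)) P :=
      fun i j => ((hint x i j).sub (hint y i j)).const_mul _
    have e : Q = ∫ θ, ∑ i, ∑ j, D i j * (ξ x θ i * ξ x θ j - ξ y θ i * ξ y θ j) ∂P := by
      rw [integral_finsetSum _ fun i _ => integrable_finsetSum _ fun j _ => hI i j, hQ]
      refine Finset.sum_congr rfl fun i _ => ?_
      rw [integral_finsetSum _ fun j _ => hI i j]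
      refine Finset.sum_congr rfl fun j _ => ?_
      rw [integral_const_mul, integral_sub (hint x i j) (hint y i j), ← hS, ← hS, pow_two]
    have l : ∫ θ, ∑ i, ∑ j, D i j * (ξ x θ i * ξ x θ j - ξ y θ i * ξ y θ j) ∂P
        ≤ ∫ _, (Q + C) / 2 ∂P := by
      refine integral_mono_ae
        (integrable_finsetSum _ fun i _ => integrable_finsetSum _ fun j _ => hI i j)
        (integrable_const _) ?_
      filter_upwards [hC] with θ h
      have h2 : ∑ i, ∑ j, D i j * (ξ x θ i * ξ x θ j - ξ y θ i * ξ y θ j) ≤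
          ∑ i, ∑ j, ((D i j) ^ 2 / 2 + (ξ x θ i * ξ x θ j - ξ y θ i * ξ y θ j) ^ 2 / 2) :=
        Finset.sum_le_sum fun i _ => Finset.sum_le_sum fun j _ => by
          nlinarith [sq_nonneg (D i j - (ξ x θ i * ξ x θ j - ξ y θ i * ξ y θ j))]
      simp only [Finset.sum_add_distrib, ← Finset.sum_div] at h2
      change _ ≤ Q / 2 + _ at h2
      linarith
    rw [← e] at l
    simp at l
    linarith
  have hr := norm_nonneg (x - y)
  have hb : ∀ᵐ θ ∂P, ∑ i, ∑ j, (ξ x θ i * ξ x θ j - ξ y θ i * ξ y θ j) ^ 2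
      ≤ 4 * β ^ 2 * ‖ξ x θ - ξ y θ‖ ^ 2 := by
    filter_upwards [hbound x, hbound y] with θ h1 h2
    have h3 : ‖ξ x θ‖ ^ 2 ≤ β ^ 2 := by gcongr
    have h4 : ‖ξ y θ‖ ^ 2 ≤ β ^ 2 := by gcongr
    have := ncr_pointwise (ξ x θ) (ξ y θ)
    nlinarith [sq_nonneg ‖ξ x θ - ξ y θ‖]
  refine ⟨?_, key _ ?_, key _ ?_⟩
  · have e : (S x).trace = ∫ θ, ‖ξ x θ‖ ^ 2 ∂P := by
      simp only [EuclideanSpace.real_norm_sq_eq, Matrix.trace, Matrix.diag, hS]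
      simp only [pow_two]
      rw [integral_finsetSum _ fun i _ => hint x i i]
    rw [e]
    have : ∫ θ, ‖ξ x θ‖ ^ 2 ∂P ≤ ∫ _, β ^ 2 ∂P := by
      refine integral_mono_of_nonneg (Filter.Eventually.of_forall fun θ => sq_nonneg _)
        (integrable_const _) ?_
      filter_upwards [hbound x] with θ h
      gcongr
    simpa using this
  · filter_upwards [hb, hlip x y] with θ h1 h2
    have h3 : ‖ξ x θ - ξ y θ‖ ^ 2 ≤ (Lξ * ‖x - y‖) ^ 2 := by gcongr
    have h4 : 4 * β ^ 2 * ‖ξ x θ - ξ y θ‖ ^ 2 ≤ 4 * β ^ 2 * (Lξ * ‖x - y‖) ^ 2 := by gcongr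
    have h5 : 0 ≤ β ^ 2 * (Lξ * ‖x - y‖) ^ 2 := by positivity
    nlinarith
  · filter_upwards [hb, hlip x y, hbound x, hbound y] with θ h1 h2 h3 h4
    have h5 : ‖ξ x θ - ξ y θ‖ ≤ 2 * β := (norm_sub_le _ _).trans (by linarith)
    have h6 : ‖ξ x θ - ξ y θ‖ ^ 2 ≤ (2 * β) * (Lξ * ‖x - y‖) := by
      rw [pow_two]; gcongr
    have h7 : 4 * β ^ 2 * ‖ξ x θ - ξ y θ‖ ^ 2 ≤ 4 * β ^ 2 * ((2 * β) * (Lξ * ‖x - y‖)) := by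
      gcongr
    have h8 : 0 ≤ β ^ 3 * Lξ * ‖x - y‖ := by positivity
    nlinarith
end

section
/- For all x, y ∈ ℝ^d the matrices N(x) satisfy: (1) tr(N(x)²) ≤ β²; (2) tr((N(x) − N(y))²) ≤ L_N²·‖x − y‖₂²; and (3) tr((N(x) − N(y))²) ≤ (8β²/c_m)·L_N·‖x − y‖₂. -/
open MeasureTheory

lemma aux_lower {d : ℕ} (A : Matrix (Fin d) (Fin d) ℝ) (c : ℝ) (hc : 0 < c)
    (hA : A.PosSemidef) (h : (A ^ 2 - c ^ 2 • (1 : Matrix (Fin d) (Fin d) ℝ)).PosSemidef) :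
    (A - c • (1 : Matrix (Fin d) (Fin d) ℝ)).PosSemidef := by
  have hM : (A - c • (1 : Matrix (Fin d) (Fin d) ℝ)).IsHermitian := by
    refine hA.1.sub ?_
    simp [Matrix.IsHermitian]
  rw [hM.posSemidef_iff_eigenvalues_nonneg]
  intro i
  have hv := hM.mulVec_eigenvectorBasis i
  have hne : (hM.eigenvectorBasis i).ofLp ≠ 0 := by
    intro h0
    have h1 := hM.eigenvectorBasis.orthonormal.1 i
    rw [(WithLp.ofLp_eq_zero 2).1 h0] at h1
    simp at h1
  set v : Fin d → ℝ := (hM.eigenvectorBasis i).ofLp with hvdef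
  set μ := hM.eigenvalues i with hμ
  have hpos : 0 < v ⬝ᵥ v := by
    have h1 : 0 ≤ v ⬝ᵥ v := by
      simp only [dotProduct]; exact Finset.sum_nonneg fun i _ => mul_self_nonneg _
    exact lt_of_le_of_ne h1 (fun h => hne (dotProduct_self_eq_zero.1 h.symm))
  have hAv : A.mulVec v = (μ + c) • v := by
    rw [Matrix.sub_mulVec, Matrix.smul_mulVec, Matrix.one_mulVec, sub_eq_iff_eq_add] at hv
    rw [hv, add_smul]
  have h1 := hA.dotProduct_mulVec_nonneg v
  have h2 := h.dotProduct_mulVec_nonneg v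
  rw [hAv] at h1
  rw [Matrix.sub_mulVec, Matrix.smul_mulVec, Matrix.one_mulVec, pow_two, ← Matrix.mulVec_mulVec,
    hAv, Matrix.mulVec_smul, hAv] at h2
  simp only [star_trivial, dotProduct_sub, dotProduct_smul, smul_eq_mul] at h1 h2
  have h3 : 0 ≤ μ + c := nonneg_of_mul_nonneg_left h1 hpos
  have h4 : 0 ≤ μ * (μ + 2 * c) := by
    refine nonneg_of_mul_nonneg_left (b := v ⬝ᵥ v) ?_ hpos
    nlinarith
  change 0 ≤ μ
  exact nonneg_of_mul_nonneg_left h4 (by linarith)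

lemma aux_bilin {d : ℕ} (D : Matrix (Fin d) (Fin d) ℝ) (a b : EuclideanSpace ℝ (Fin d)) :
    ∑ i, ∑ j, D i j * (a i * b j) ≤ √(∑ i, ∑ j, D i j ^ 2) * (‖a‖ * ‖b‖) := by
  have h := Real.sum_mul_le_sqrt_mul_sqrt (Finset.univ : Finset (Fin d × Fin d))
    (fun p => D p.1 p.2) (fun p => a p.1 * b p.2)
  simp only [Fintype.sum_prod_type] at h
  refine h.trans (le_of_eq ?_)
  congr 1
  rw [EuclideanSpace.norm_eq, EuclideanSpace.norm_eq, ← Real.sqrt_mul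
    (Finset.sum_nonneg fun i _ => sq_nonneg _), Finset.sum_mul_sum]
  simp [mul_pow]

lemma aux_trace_sq {d : ℕ} (D : Matrix (Fin d) (Fin d) ℝ) (hD : D.IsHermitian) :
    (D ^ 2).trace = ∑ i, ∑ j, D i j ^ 2 := by
  simp only [Matrix.trace, Matrix.diag, pow_two, Matrix.mul_apply]
  refine Finset.sum_congr rfl fun i _ => Finset.sum_congr rfl fun j _ => ?_
  have := hD.apply i j
  simp only [star_trivial] at this
  rw [this]

lemma aux_pt {d : ℕ} (D : Matrix (Fin d) (Fin d) ℝ) (u v : EuclideanSpace ℝ (Fin d))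
    (β r : ℝ) (hu : ‖u‖ ≤ β) (hv : ‖v‖ ≤ β) (hr : ‖u - v‖ ≤ r) :
    ∑ i, ∑ j, D i j * (u i * u j - v i * v j) ≤ √(∑ i, ∑ j, D i j ^ 2) * (2 * β * r) := by
  have h1 := aux_bilin D u (u - v)
  have h2 := aux_bilin D (u - v) v
  have e : ∑ i, ∑ j, D i j * (u i * u j - v i * v j) =
      ∑ i, ∑ j, D i j * (u i * (u - v) j) + ∑ i, ∑ j, D i j * ((u - v) i * v j) := by
    simp only [← Finset.sum_add_distrib]
    refine Finset.sum_congr rfl fun i _ => Finset.sum_congr rfl fun j _ => ?_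
    simp only [PiLp.sub_apply]; ring
  rw [e]
  have hβ : 0 ≤ β := (norm_nonneg _).trans hu
  have h3 : ‖u‖ * ‖u - v‖ ≤ β * r := by gcongr
  have h4 : ‖u - v‖ * ‖v‖ ≤ r * β := by
    have := (norm_nonneg _).trans hr
    gcongr
  have h0 := Real.sqrt_nonneg (∑ i, ∑ j, D i j ^ 2)
  nlinarith [mul_le_mul_of_nonneg_left h3 h0, mul_le_mul_of_nonneg_left h4 h0]

lemma aux_tr {d : ℕ} (A B : Matrix (Fin d) (Fin d) ℝ) (c : ℝ) (hA : A.IsHermitian)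
    (hB : B.IsHermitian)
    (hA' : (A - c • (1 : Matrix (Fin d) (Fin d) ℝ)).PosSemidef)
    (hB' : (B - c • (1 : Matrix (Fin d) (Fin d) ℝ)).PosSemidef) :
    2 * c * ((A - B) ^ 2).trace ≤ ((A - B) * (A ^ 2 - B ^ 2)).trace := by
  have hD : (A - B).IsHermitian := hA.sub hB
  have h1 := (hA'.conjTranspose_mul_mul_same (A - B)).trace_nonneg
  have h2 := (hB'.conjTranspose_mul_mul_same (A - B)).trace_nonneg
  rw [hD.eq] at h1 h2
  have e : ((A - B) * (A ^ 2 - B ^ 2)) = (A - B) * A * (A - B) + (A - B) * ((A - B) * B) := by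
    noncomm_ring
  have e2 : ((A - B) * ((A - B) * B)).trace = ((A - B) * B * (A - B)).trace := by
    rw [Matrix.trace_mul_comm]
  rw [e, Matrix.trace_add, e2]
  clear e e2 hD
  generalize A - B = D at h1 h2 ⊢
  rw [mul_sub, sub_mul, Matrix.trace_sub, mul_smul_comm, smul_mul_assoc, mul_one,
    Matrix.trace_smul, smul_eq_mul, ← pow_two] at h1 h2
  linarith

theorem N_regularity {d : ℕ} {Θ : Type*} [MeasurableSpace Θ]
    (P : Measure Θ) [IsProbabilityMeasure P]
    (ξ : EuclideanSpace ℝ (Fin d) → Θ → EuclideanSpace ℝ (Fin d))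
    (hmeas : ∀ x, Measurable (ξ x))
    (β Lξ cm : ℝ) (hβ : 0 < β) (hLξ : 0 < Lξ) (hcm : 0 < cm)
    (hbound : ∀ x, ∀ᵐ θ ∂P, ‖ξ x θ‖ ≤ β)
    (hlip : ∀ x y, ∀ᵐ θ ∂P, ‖ξ x θ - ξ y θ‖ ≤ Lξ * ‖x - y‖)
    (S : EuclideanSpace ℝ (Fin d) → Matrix (Fin d) (Fin d) ℝ)
    (hS : ∀ x i j, S x i j = ∫ θ, ξ x θ i * ξ x θ j ∂P)
    (hSpsd : ∀ x, (S x).PosSemidef)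
    (hSlb : ∀ x, (S x - (4 * cm ^ 2) • (1 : Matrix (Fin d) (Fin d) ℝ)).PosSemidef)
    (N : EuclideanSpace ℝ (Fin d) → Matrix (Fin d) (Fin d) ℝ)
    (hNpsd : ∀ x, (N x).PosSemidef)
    (hNsq : ∀ x, N x ^ 2 = S x - cm ^ 2 • (1 : Matrix (Fin d) (Fin d) ℝ)) :
    ∀ x y : EuclideanSpace ℝ (Fin d),
      (N x ^ 2).trace ≤ β ^ 2 ∧
      ((N x - N y) ^ 2).trace ≤ (4 * β * Lξ / cm) ^ 2 * ‖x - y‖ ^ 2 ∧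
      ((N x - N y) ^ 2).trace ≤ 8 * β ^ 2 / cm * (4 * β * Lξ / cm) * ‖x - y‖ := by
  have hcoord : ∀ x i, AEStronglyMeasurable (fun θ => ξ x θ i) P := fun x i =>
    ((by fun_prop : Measurable fun v : EuclideanSpace ℝ (Fin d) => v i).comp
      (hmeas x)).aestronglyMeasurable
  have hint : ∀ x i j, Integrable (fun θ => ξ x θ i * ξ x θ j) P := by
    intro x i j
    refine Integrable.of_bound ((hcoord x i).mul (hcoord x j)) (β * β) ?_
    filter_upwards [hbound x] with θ hθ
    rw [norm_mul]
    have h1 := (PiLp.norm_apply_le (ξ x θ) i).trans hθ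
    have h2 := (PiLp.norm_apply_le (ξ x θ) j).trans hθ
    gcongr
  have hStr : ∀ x, (S x).trace ≤ β ^ 2 := by
    intro x
    have : (S x).trace = ∫ θ, ∑ i, ξ x θ i * ξ x θ i ∂P := by
      rw [integral_finsetSum _ fun i _ => hint x i i]
      simp [Matrix.trace, hS]
    rw [this]
    have h2 : ∫ θ, ∑ i, ξ x θ i * ξ x θ i ∂P ≤ ∫ θ, β ^ 2 ∂P := by
      refine integral_mono_ae (integrable_finsetSum _ fun i _ => hint x i i)
        (integrable_const _) ?_
      filter_upwards [hbound x] with θ hθ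
      have h3 : ∑ i, ξ x θ i * ξ x θ i = ‖ξ x θ‖ ^ 2 := by
        rw [EuclideanSpace.norm_sq_eq]; simp [pow_two]
      rw [h3]
      gcongr
    simpa using h2
  have hN1 : ∀ x, (N x ^ 2).trace ≤ β ^ 2 := by
    intro x
    rw [hNsq, Matrix.trace_sub, Matrix.trace_smul, Matrix.trace_one, smul_eq_mul]
    have := hStr x
    have : 0 ≤ cm ^ 2 * (Fintype.card (Fin d) : ℝ) := by positivity
    linarith
  have hlow : ∀ x, (N x - cm • (1 : Matrix (Fin d) (Fin d) ℝ)).PosSemidef := by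
    intro x
    refine aux_lower _ _ hcm (hNpsd x) ?_
    have e : N x ^ 2 - cm ^ 2 • (1 : Matrix (Fin d) (Fin d) ℝ) =
        (S x - (4 * cm ^ 2) • (1 : Matrix (Fin d) (Fin d) ℝ)) +
        (2 * cm ^ 2) • (1 : Matrix (Fin d) (Fin d) ℝ) := by
      rw [hNsq]; module
    rw [e]
    exact (hSlb x).add (Matrix.PosSemidef.one.smul (by positivity))
  intro x y
  have hD : (N x - N y).IsHermitian := (hNpsd x).1.sub (hNpsd y).1
  set D := N x - N y with hDdef
  set f := √(∑ i, ∑ j, D i j ^ 2) with hf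
  have hf0 : 0 ≤ f := Real.sqrt_nonneg _
  have hf2 : (D ^ 2).trace = f ^ 2 := by
    rw [aux_trace_sq D hD, hf, Real.sq_sqrt]
    exact Finset.sum_nonneg fun i _ => Finset.sum_nonneg fun j _ => sq_nonneg _
  have h1 := aux_tr (N x) (N y) cm (hNpsd x).1 (hNpsd y).1 (hlow x) (hlow y)
  rw [← hDdef, hf2] at h1
  have h2 : (D * (N x ^ 2 - N y ^ 2)).trace =
      ∫ θ, ∑ i, ∑ j, D i j * (ξ x θ i * ξ x θ j - ξ y θ i * ξ y θ j) ∂P := by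
    have hI : ∀ i j, Integrable
        (fun θ => D i j * (ξ x θ i * ξ x θ j - ξ y θ i * ξ y θ j)) P :=
      fun i j => ((hint x i j).sub (hint y i j)).const_mul _
    rw [integral_finsetSum _ fun i _ => integrable_finsetSum _ fun j _ => hI i j]
    have e : N x ^ 2 - N y ^ 2 = S x - S y := by rw [hNsq, hNsq]; abel
    rw [e]
    simp only [Matrix.trace, Matrix.diag, Matrix.mul_apply]
    refine Finset.sum_congr rfl fun i _ => ?_
    rw [integral_finsetSum _ fun j _ => hI i j]
    refine Finset.sum_congr rfl fun j _ => ?_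
    rw [integral_const_mul, integral_sub (hint x i j) (hint y i j), ← hS, ← hS,
      Matrix.sub_apply]
    have a1 := (hSpsd x).1.apply i j
    have a2 := (hSpsd y).1.apply i j
    simp only [star_trivial] at a1 a2
    rw [a1, a2]
  have h3 : ∫ θ, ∑ i, ∑ j, D i j * (ξ x θ i * ξ x θ j - ξ y θ i * ξ y θ j) ∂P
      ≤ ∫ θ, f * (2 * β * (Lξ * ‖x - y‖)) ∂P := by
    refine integral_mono_ae (integrable_finsetSum _ fun i _ => integrable_finsetSum _ fun j _ =>
      ((hint x i j).sub (hint y i j)).const_mul _) (integrable_const _) ?_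
    filter_upwards [hbound x, hbound y, hlip x y] with θ a b c
    exact aux_pt D _ _ _ _ a b c
  rw [← h2] at h3
  simp only [integral_const, probReal_univ, one_smul] at h3
  set r := ‖x - y‖ with hr
  have hr0 : 0 ≤ r := norm_nonneg _
  have h4 : f * cm ≤ β * Lξ * r := by
    rcases hf0.eq_or_lt with h | h
    · rw [← h, zero_mul]; positivity
    · refine le_of_mul_le_mul_left ?_ h
      nlinarith
  have h5 : f ≤ 4 * β * Lξ / cm * r := by
    rw [div_mul_eq_mul_div, le_div_iff₀ hcm]
    have : 0 ≤ β * Lξ * r := by positivity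
    linarith
  refine ⟨hN1 x, ?_, ?_⟩
  · rw [hf2, ← mul_pow]
    gcongr
  · rcases Nat.eq_zero_or_pos d with h | hd
    · subst h
      have : (D ^ 2).trace = 0 := by simp [Matrix.trace]
      rw [this]; positivity
    have h6 : f ≤ 2 * β := by
      refine (pow_le_pow_iff_left₀ hf0 (by positivity) two_ne_zero).1 ?_
      have hsum : 0 ≤ ((N x + N y) ^ 2).trace := by
        rw [aux_trace_sq _ ((hNpsd x).1.add (hNpsd y).1)]
        exact Finset.sum_nonneg fun i _ => Finset.sum_nonneg fun j _ => sq_nonneg _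
      have e : D ^ 2 + (N x + N y) ^ 2 = (2 : ℝ) • N x ^ 2 + (2 : ℝ) • N y ^ 2 := by
        rw [hDdef, two_smul, two_smul]; noncomm_ring
      have e' := congrArg Matrix.trace e
      simp only [Matrix.trace_add, Matrix.trace_smul, smul_eq_mul, hf2] at e'
      nlinarith [hN1 x, hN1 y]
    have h7 : cm ≤ 4 * β := by
      have := (hSlb x).trace_nonneg
      rw [Matrix.trace_sub, Matrix.trace_smul, Matrix.trace_one, smul_eq_mul,
        Fintype.card_fin] at this
      have h8 : (1 : ℝ) ≤ d := by exact_mod_cast hd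
      have h9 := hStr x
      have : cm ≤ β := by
        refine (pow_le_pow_iff_left₀ hcm.le hβ.le two_ne_zero).1 ?_
        nlinarith [sq_nonneg cm]
      linarith
    have h8 : 2 * β ≤ 8 * β ^ 2 / cm := by
      rw [le_div_iff₀ hcm]; nlinarith
    rw [hf2, pow_two, mul_assoc (8 * β ^ 2 / cm)]
    exact mul_le_mul (h6.trans h8) h5 hf0 (by positivity)
end

section
/- Let A and B be n×n real symmetric positive definite matrices, and let √A and √B denote their unique positive semidefinite square roots. Then tr((√A − √B)²) ≤ tr((A − B)²·A⁻¹). -/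
open scoped MatrixOrder in
lemma psd_factor {n : ℕ} {S : Matrix (Fin n) (Fin n) ℝ} (h : S.PosSemidef) :
    ∃ R : Matrix (Fin n) (Fin n) ℝ, S = R.conjTranspose * R :=
  CStarAlgebra.nonneg_iff_eq_star_mul_self.mp h.nonneg

theorem trace_sqrt_diff_le {n : ℕ} (A B sA sB : Matrix (Fin n) (Fin n) ℝ)
    (hA : A.PosDef) (hB : B.PosDef)
    (hsA : sA.PosSemidef) (hsA2 : sA ^ 2 = A)
    (hsB : sB.PosSemidef) (hsB2 : sB ^ 2 = B) :
    ((sA - sB) ^ 2).trace ≤ ((A - B) ^ 2 * A⁻¹).trace := by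
  have hu : IsUnit sA := by
    have := hA.isUnit
    rw [← hsA2] at this
    exact (isUnit_pow_iff two_ne_zero).1 this
  have hdet : IsUnit sA.det := (Matrix.isUnit_iff_isUnit_det _).1 hu
  obtain ⟨I, hI⟩ : ∃ I, I = sA⁻¹ := ⟨_, rfl⟩
  have hIl : I * sA = 1 := by rw [hI]; exact Matrix.nonsing_inv_mul _ hdet
  have hIr : sA * I = 1 := by rw [hI]; exact Matrix.mul_nonsing_inv _ hdet
  have hIpsd : I.PosSemidef := hI ▸ hsA.inv
  have hAinv : A⁻¹ = I * I := by
    rw [← hsA2, pow_two, Matrix.mul_inv_rev, hI]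
  obtain ⟨D, hD⟩ : ∃ D, D = sA - sB := ⟨_, rfl⟩
  have hDh : D.conjTranspose = D := by
    rw [hD, Matrix.conjTranspose_sub, hsA.1.eq, hsB.1.eq]
  have h1 : I * (A - B) = D + I * D * sB := by
    have : A - B = sA * D + D * sB := by rw [← hsA2, ← hsB2, hD]; noncomm_ring
    rw [this, mul_add, ← mul_assoc, hIl, one_mul, mul_assoc]
  have h2 : (A - B) * I = D + sB * D * I := by
    have : A - B = D * sA + sB * D := by rw [← hsA2, ← hsB2, hD]; noncomm_ring
    rw [this, add_mul, mul_assoc, hIr, mul_one]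
  have h3 : ((A - B) ^ 2 * A⁻¹).trace = ((D + sB * D * I) * (D + I * D * sB)).trace := by
    rw [← h1, ← h2, hAinv, pow_two, mul_assoc, Matrix.trace_mul_comm]
    congr 1
    noncomm_ring
  have h4 : 0 ≤ (D * I * D * sB).trace := by
    obtain ⟨R, hR⟩ := psd_factor hsB
    have h := ((hIpsd.conjTranspose_mul_mul_same D).mul_mul_conjTranspose_same R).trace_nonneg
    rw [hDh, Matrix.trace_mul_comm, ← mul_assoc, ← hR, Matrix.trace_mul_comm] at h
    exact h
  have h5 : 0 ≤ ((sB * D * I) * (I * D * sB)).trace := by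
    have h := (Matrix.posSemidef_conjTranspose_mul_self (I * D * sB)).trace_nonneg
    rw [Matrix.conjTranspose_mul, Matrix.conjTranspose_mul, hDh, hsB.1.eq, hIpsd.1.eq,
      ← mul_assoc sB] at h
    exact h
  have h6 : (sB * D * I * D).trace = (D * I * D * sB).trace := by
    rw [Matrix.trace_mul_comm (D * I * D)]
    simp only [mul_assoc]
  rw [h3, ← hD, add_mul, mul_add, mul_add, pow_two]
  simp only [Matrix.trace_add]
  have h7 : (D * (I * D * sB)).trace = (D * I * D * sB).trace := by simp only [mul_assoc]
  linarith
end

section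
/- If δ ≤ m/(16L²) and E[‖W_0‖₂²] ≤ 2·(R² + β²/m), then for every k ≥ 0 one has E[‖W_k‖₂²] ≤ 8·(R² + β²/m). -/
open MeasureTheory RealInnerProductSpace

lemma sgd_aux_v {E : Type*} [NormedAddCommGroup E] [InnerProductSpace ℝ E]
    (x a : E) (L m R δ : ℝ) (hm : 0 < m) (hR : 0 < R) (hδ : 0 < δ)
    (ha : ‖a‖ ≤ L * ‖x‖) (hd : R ≤ ‖x‖ → m * ‖x‖ ^ 2 ≤ ⟪a, x⟫)
    (hδL : δ * L ^ 2 ≤ m / 16) :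
    ‖(1 - R / max R ‖x‖) • x - δ • a‖ ^ 2 ≤
      (1 - 15 / 8 * (δ * m)) * (max (‖x‖ - R) 0) ^ 2 + δ * m * R ^ 2 / 8 := by
  have ha2 : δ ^ 2 * ‖a‖ ^ 2 ≤ δ * (m / 16) * ‖x‖ ^ 2 := by
    have h1 : ‖a‖ ^ 2 ≤ L ^ 2 * ‖x‖ ^ 2 := by
      rw [← mul_pow]; exact pow_le_pow_left₀ (norm_nonneg _) ha 2
    calc δ ^ 2 * ‖a‖ ^ 2 ≤ δ ^ 2 * (L ^ 2 * ‖x‖ ^ 2) := by gcongr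
      _ = δ * (δ * L ^ 2) * ‖x‖ ^ 2 := by ring
      _ ≤ _ := by gcongr
  have hδm : 0 < δ * m := by positivity
  rcases le_total ‖x‖ R with h | h
  · have h0 : max R ‖x‖ = R := max_eq_left h
    have h1 : max (‖x‖ - R) 0 = 0 := max_eq_right (by linarith)
    rw [h0, h1, div_self hR.ne']
    have : ‖(1 - 1 : ℝ) • x - δ • a‖ ^ 2 = δ ^ 2 * ‖a‖ ^ 2 := by
      simp [norm_smul, mul_pow]
    rw [this]
    have : ‖x‖ ^ 2 ≤ R ^ 2 := pow_le_pow_left₀ (norm_nonneg _) h 2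
    nlinarith [sq_nonneg R]
  · have h0 : max R ‖x‖ = ‖x‖ := max_eq_right h
    have h1 : max (‖x‖ - R) 0 = ‖x‖ - R := max_eq_left (by linarith)
    have hx : 0 < ‖x‖ := hR.trans_le h
    rw [h0, h1, norm_sub_sq_real, norm_smul, norm_smul, real_inner_smul_left,
      real_inner_smul_right, real_inner_comm, mul_pow, mul_pow, Real.norm_eq_abs, Real.norm_eq_abs,
      sq_abs, sq_abs]
    have hc : (1 - R / ‖x‖) * ‖x‖ = ‖x‖ - R := by field_simp
    have hc0 : 0 ≤ 1 - R / ‖x‖ := by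
      rw [sub_nonneg, div_le_one hx]; exact h
    have h2 : (‖x‖ - R) * (m * ‖x‖) ≤ (1 - R / ‖x‖) * ⟪a, x⟫ := by
      calc (‖x‖ - R) * (m * ‖x‖) = (1 - R / ‖x‖) * (m * ‖x‖ ^ 2) := by rw [← hc]; ring
        _ ≤ _ := mul_le_mul_of_nonneg_left (hd h) hc0
    have h3 : (1 - R / ‖x‖) ^ 2 * ‖x‖ ^ 2 = (‖x‖ - R) ^ 2 := by rw [← hc]; ring
    rw [h3]
    have h4 := mul_le_mul_of_nonneg_left h2 hδ.le
    have h5 : (‖x‖ - R) * (‖x‖ - R) ≤ (‖x‖ - R) * ‖x‖ :=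
      mul_le_mul_of_nonneg_left (by linarith) (by linarith)
    have h6 := mul_le_mul_of_nonneg_left h5 hδm.le
    have h7 : ‖x‖ ^ 2 ≤ 2 * (‖x‖ - R) ^ 2 + 2 * R ^ 2 := by nlinarith [sq_nonneg (‖x‖ - R - R)]
    have h8 := mul_le_mul_of_nonneg_left h7 hδm.le
    nlinarith

lemma sgd_aux_g {E : Type*} [NormedAddCommGroup E] [InnerProductSpace ℝ E]
    (x a z : E) (R δ β : ℝ) (hR : 0 < R) (hδ : 0 < δ) (hz : ‖z‖ ≤ β) :
    (max (‖x - δ • a + Real.sqrt δ • z‖ - R) 0) ^ 2 ≤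
      ‖(1 - R / max R ‖x‖) • x - δ • a‖ ^ 2
        + 2 * Real.sqrt δ * ⟪(1 - R / max R ‖x‖) • x - δ • a, z⟫ + δ * β ^ 2 := by
  set v := (1 - R / max R ‖x‖) • x - δ • a with hv
  have hy : x - δ • a + Real.sqrt δ • z = (v + Real.sqrt δ • z) + (R / max R ‖x‖) • x := by
    rw [hv, sub_smul, one_smul]; abel
  have hM : 0 < max R ‖x‖ := lt_max_of_lt_left hR
  have hp : ‖(R / max R ‖x‖) • x‖ ≤ R := by
    rw [norm_smul, Real.norm_of_nonneg (by positivity), div_mul_eq_mul_div, div_le_iff₀ hM]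
    exact mul_le_mul_of_nonneg_left (le_max_right _ _) hR.le
  have h1 : max (‖x - δ • a + Real.sqrt δ • z‖ - R) 0 ≤ ‖v + Real.sqrt δ • z‖ := by
    apply max_le _ (norm_nonneg _)
    rw [hy]
    linarith [norm_add_le (v + Real.sqrt δ • z) ((R / max R ‖x‖) • x)]
  refine (pow_le_pow_left₀ (le_max_right _ _) h1 2).trans ?_
  rw [norm_add_sq_real, norm_smul, mul_pow, real_inner_smul_right, Real.norm_eq_abs, sq_abs,
    Real.sq_sqrt hδ.le]
  have : δ * ‖z‖ ^ 2 ≤ δ * β ^ 2 := by gcongr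
  linarith

theorem sgd_energy_bound {d : ℕ} (hd : 1 ≤ d)
    {Ω : Type*} [MeasurableSpace Ω] (μ : Measure Ω) [IsProbabilityMeasure μ]
    (U : EuclideanSpace ℝ (Fin d) → ℝ)
    (U' : EuclideanSpace ℝ (Fin d) → EuclideanSpace ℝ (Fin d))
    (hUgrad : ∀ x, HasGradientAt U (U' x) x)
    (hU'cont : Continuous U')
    (L m R β δ : ℝ) (hL : 0 < L) (hm : 0 < m) (hR : 0 < R) (hβ : 0 < β) (hδ : 0 < δ)
    (hU'0 : U' 0 = 0)
    (hLip : ∀ x y, ‖U' x - U' y‖ ≤ L * ‖x - y‖)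
    (hdiss : ∀ x y : EuclideanSpace ℝ (Fin d), R ≤ ‖x - y‖ →
      m * ‖x - y‖ ^ 2 ≤ ⟪U' x - U' y, x - y⟫)
    (W ξ : ℕ → Ω → EuclideanSpace ℝ (Fin d))
    (hWmeas : ∀ k, Measurable (W k)) (hξmeas : ∀ k, Measurable (ξ k))
    (hrec : ∀ k ω, W (k + 1) ω = W k ω - δ • U' (W k ω) + Real.sqrt δ • ξ k ω)
    (hξbound : ∀ k, ∀ᵐ ω ∂μ, ‖ξ k ω‖ ≤ β)
    (hcond : ∀ k,
      μ[ξ k | MeasurableSpace.comap (W 0) inferInstance ⊔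
          ⨆ i ∈ Finset.range k, MeasurableSpace.comap (ξ i) inferInstance]
        =ᵐ[μ] fun _ => 0)
    (hδm : δ ≤ m / (16 * L ^ 2))
    (hInt0 : Integrable (fun ω => ‖W 0 ω‖ ^ 2) μ)
    (hW0 : (∫ ω, ‖W 0 ω‖ ^ 2 ∂μ) ≤ 2 * (R ^ 2 + β ^ 2 / m)) :
    ∀ k : ℕ, (∫ ω, ‖W k ω‖ ^ 2 ∂μ) ≤ 8 * (R ^ 2 + β ^ 2 / m) := by
  have hLL : 0 < L ^ 2 := by positivity
  have hδL : δ * L ^ 2 ≤ m / 16 := by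
    rw [le_div_iff₀ (by positivity)] at hδm; linarith
  have hUn : ∀ x, ‖U' x‖ ≤ L * ‖x‖ := fun x => by simpa [hU'0] using hLip x 0
  have hUd : ∀ x, R ≤ ‖x‖ → m * ‖x‖ ^ 2 ≤ ⟪U' x, x⟫ := fun x hx => by
    simpa [hU'0] using hdiss x 0 (by simpa using hx)
  have hmL : m ≤ L := by
    have : Nonempty (Fin d) := ⟨⟨0, hd⟩⟩
    obtain ⟨x, hx⟩ := exists_norm_eq (EuclideanSpace ℝ (Fin d)) hR.le
    have h1 := hUd x hx.ge
    have h2 := real_inner_le_norm (U' x) x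
    have h3 := mul_le_mul_of_nonneg_right (hUn x) (norm_nonneg x)
    rw [hx] at h1 h2 h3
    have : m * R ^ 2 ≤ L * R ^ 2 := by nlinarith
    exact le_of_mul_le_mul_right this (by positivity)
  have hδm1 : δ * m ≤ 1 / 16 := by
    have : δ * m * m ≤ 1 / 16 * m := by
      have : δ * (m * m) ≤ δ * (L * L) := by gcongr
      nlinarith
    exact le_of_mul_le_mul_right this hm
  -- square integrability
  have hξ2 : ∀ k, MemLp (ξ k) 2 μ := fun k =>
    MemLp.of_bound (hξmeas k).aestronglyMeasurable β (hξbound k)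
  have hU2 : ∀ k, MemLp (W k) 2 μ → MemLp (fun ω => U' (W k ω)) 2 μ := fun k h =>
    h.of_le_mul (c := L) (hU'cont.measurable.comp (hWmeas k)).aestronglyMeasurable
      (Filter.Eventually.of_forall fun ω => hUn _)
  have hW2 : ∀ k, MemLp (W k) 2 μ := by
    intro k
    induction k with
    | zero => exact (memLp_two_iff_integrable_sq_norm (hWmeas 0).aestronglyMeasurable).2 hInt0
    | succ k ih =>
      have : W (k + 1) = fun ω => W k ω - δ • U' (W k ω) + Real.sqrt δ • ξ k ω :=
        funext (hrec k)
      rw [this]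
      exact (ih.sub ((hU2 k ih).const_smul δ)).add ((hξ2 k).const_smul (Real.sqrt δ))
  -- adaptedness
  let F : ℕ → MeasurableSpace Ω := fun k => MeasurableSpace.comap (W 0) inferInstance ⊔
          ⨆ i ∈ Finset.range k, MeasurableSpace.comap (ξ i) inferInstance
  have hF : ∀ k, F k ≤ ‹MeasurableSpace Ω› := fun k =>
    sup_le (hWmeas 0).comap_le (iSup₂_le fun i _ => (hξmeas i).comap_le)
  have hFmono : ∀ k, F k ≤ F (k + 1) := fun k =>
    sup_le_sup le_rfl (biSup_mono fun i hi => by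
      simp only [Finset.mem_range] at hi ⊢; omega)
  have hFξ : ∀ k, Measurable[F (k + 1)] (ξ k) := fun k => by
    apply Measurable.mono (comap_measurable (ξ k)) _ le_rfl
    exact le_sup_of_le_right (le_iSup₂_of_le k (by simp) le_rfl)
  have hFW : ∀ k, Measurable[F k] (W k) := by
    intro k
    induction k with
    | zero => exact Measurable.mono (comap_measurable (W 0)) le_sup_left le_rfl
    | succ k ih =>
      have : W (k + 1) = fun ω => W k ω - δ • U' (W k ω) + Real.sqrt δ • ξ k ω :=
        funext (hrec k)
      rw [this]
      have h1 : Measurable[F (k + 1)] (W k) := ih.mono (hFmono k) le_rfl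
      have h2 := hFξ k
      have h3 : Measurable[F (k + 1)] (fun ω => U' (W k ω)) := hU'cont.measurable.comp h1
      exact (h1.sub (h3.const_smul δ)).add (h2.const_smul (Real.sqrt δ))
  -- the shifted map
  let v : EuclideanSpace ℝ (Fin d) → EuclideanSpace ℝ (Fin d) :=
    fun x => (1 - R / max R ‖x‖) • x - δ • U' x
  have hvcont : Continuous v := by
    have : ∀ x : EuclideanSpace ℝ (Fin d), max R ‖x‖ ≠ 0 := fun x =>
      (lt_max_of_lt_left hR).ne'
    have h1 : Continuous fun x : EuclideanSpace ℝ (Fin d) => 1 - R / max R ‖x‖ :=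
      continuous_const.sub (continuous_const.div (continuous_const.max continuous_norm) this)
    exact (h1.smul continuous_id).sub (hU'cont.const_smul δ)
  have hvn : ∀ x, ‖v x‖ ≤ (1 + δ * L) * ‖x‖ := by
    intro x
    have hM : 0 < max R ‖x‖ := lt_max_of_lt_left hR
    have h1 : ‖(1 - R / max R ‖x‖) • x‖ ≤ 1 * ‖x‖ := by
      rw [norm_smul]
      gcongr
      rw [Real.norm_eq_abs, abs_le]
      have : R / max R ‖x‖ ≤ 1 := (div_le_one hM).2 (le_max_left _ _)
      have : 0 ≤ R / max R ‖x‖ := by positivity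
      constructor <;> linarith
    have h2 : ‖δ • U' x‖ ≤ δ * (L * ‖x‖) := by
      rw [norm_smul, Real.norm_of_nonneg hδ.le]
      exact mul_le_mul_of_nonneg_left (hUn x) hδ.le
    have := norm_sub_le ((1 - R / max R ‖x‖) • x) (δ • U' x)
    show ‖(1 - R / max R ‖x‖) • x - δ • U' x‖ ≤ _
    linarith
  have hv2 : ∀ k, MemLp (fun ω => v (W k ω)) 2 μ := fun k =>
    (hW2 k).of_le_mul (c := 1 + δ * L) (hvcont.measurable.comp (hWmeas k)).aestronglyMeasurable
      (Filter.Eventually.of_forall fun ω => hvn _)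
  have hcrossInt : ∀ k, Integrable (fun ω => ⟪v (W k ω), ξ k ω⟫) μ := by
    intro k
    refine (((hv2 k).integrable (by norm_num)).norm.mul_const β).mono'
      ((hv2 k).aestronglyMeasurable.inner (hξ2 k).aestronglyMeasurable) ?_
    filter_upwards [hξbound k] with ω hω
    exact (norm_inner_le_norm _ _).trans (mul_le_mul_of_nonneg_left hω (norm_nonneg _))
  have hcross : ∀ k, ∫ ω, ⟪v (W k ω), ξ k ω⟫ ∂μ = 0 := by
    intro k
    have hsm : StronglyMeasurable[F k] (fun ω => v (W k ω)) :=
      (hvcont.measurable.comp (hFW k)).stronglyMeasurable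
    have h1 := condExp_bilin_of_stronglyMeasurable_left (m := F k) (μ := μ)
      (innerSL ℝ) hsm (hcrossInt k) ((hξ2 k).integrable (by norm_num))
    rw [← integral_condExp (hF k)]
    have h2 : μ[fun ω => ⟪v (W k ω), ξ k ω⟫ | F k] =ᵐ[μ] fun _ => (0 : ℝ) := by
      refine h1.trans ?_
      filter_upwards [hcond k] with ω hω
      have hω' : (μ[ξ k | F k]) ω = 0 := hω
      rw [hω']; simp
    rw [integral_congr_ae h2]; simp
  -- Lyapunov function
  have hWsq : ∀ k, Integrable (fun ω => ‖W k ω‖ ^ 2) μ := fun k =>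
    (memLp_two_iff_integrable_sq_norm (hWmeas k).aestronglyMeasurable).1 (hW2 k)
  have hgle : ∀ r : ℝ, 0 ≤ r → (max (r - R) 0) ^ 2 ≤ r ^ 2 := fun r hr =>
    pow_le_pow_left₀ (le_max_right _ _) (max_le (by linarith) hr) 2
  have hgInt : ∀ k, Integrable (fun ω => (max (‖W k ω‖ - R) 0) ^ 2) μ := fun k => by
    refine (hWsq k).mono' ?_ (Filter.Eventually.of_forall fun ω => ?_)
    · exact ((((hWmeas k).norm.sub_const R).max measurable_const).pow_const 2).aestronglyMeasurable
    · rw [Real.norm_of_nonneg (sq_nonneg _)]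
      exact hgle _ (norm_nonneg _)
  have hstep : ∀ k, ∫ ω, (max (‖W (k + 1) ω‖ - R) 0) ^ 2 ∂μ ≤
      (1 - 15 / 8 * (δ * m)) * ∫ ω, (max (‖W k ω‖ - R) 0) ^ 2 ∂μ
        + (δ * m * R ^ 2 / 8 + δ * β ^ 2) := by
    intro k
    have hI1 := (hgInt k).const_mul (1 - 15 / 8 * (δ * m))
    have hI2 := (hcrossInt k).const_mul (2 * Real.sqrt δ)
    have hI12 : Integrable (fun ω => (1 - 15 / 8 * (δ * m)) * (max (‖W k ω‖ - R) 0) ^ 2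
        + 2 * Real.sqrt δ * ⟪v (W k ω), ξ k ω⟫) μ := hI1.add hI2
    have hI3 : Integrable (fun _ : Ω => δ * m * R ^ 2 / 8 + δ * β ^ 2) μ := integrable_const _
    calc ∫ ω, (max (‖W (k + 1) ω‖ - R) 0) ^ 2 ∂μ
        ≤ ∫ ω, ((1 - 15 / 8 * (δ * m)) * (max (‖W k ω‖ - R) 0) ^ 2
            + 2 * Real.sqrt δ * ⟪v (W k ω), ξ k ω⟫) + (δ * m * R ^ 2 / 8 + δ * β ^ 2) ∂μ := by
          refine integral_mono_ae (hgInt (k + 1)) ((hI1.add hI2).add hI3) ?_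
          filter_upwards [hξbound k] with ω hω
          have h1 := sgd_aux_g (W k ω) (U' (W k ω)) (ξ k ω) R δ β hR hδ hω
          have h2 := sgd_aux_v (W k ω) (U' (W k ω)) L m R δ hm hR hδ (hUn _) (hUd _) hδL
          rw [← hrec k ω] at h1
          simp only [v]
          linarith
      _ = _ := by
          rw [integral_add hI12 hI3, integral_add hI1 hI2, integral_const_mul,
            integral_const_mul, hcross k]
          simp
  have hA : 0 < β ^ 2 / m := by positivity
  have hg : ∀ k, ∫ ω, (max (‖W k ω‖ - R) 0) ^ 2 ∂μ ≤ 2 * (R ^ 2 + β ^ 2 / m) := by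
    intro k
    induction k with
    | zero => exact (integral_mono (hgInt 0) (hWsq 0) fun ω => hgle _ (norm_nonneg _)).trans hW0
    | succ k ih =>
      refine (hstep k).trans ?_
      have h1 := mul_le_mul_of_nonneg_left ih (by linarith : 0 ≤ 1 - 15 / 8 * (δ * m))
      have h2 : δ * β ^ 2 = δ * m * (β ^ 2 / m) := by field_simp
      have h3 : 0 < δ * m * (β ^ 2 / m) := by positivity
      have h4 : 0 < δ * m * R ^ 2 := by positivity
      rw [h2]
      linarith
  intro k
  have h1 : ∫ ω, ‖W k ω‖ ^ 2 ∂μ ≤ ∫ ω, 2 * (max (‖W k ω‖ - R) 0) ^ 2 + 2 * R ^ 2 ∂μ := by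
    refine integral_mono (hWsq k) (((hgInt k).const_mul 2).add (integrable_const _)) fun ω => ?_
    have h2 : ‖W k ω‖ ≤ max (‖W k ω‖ - R) 0 + R := by
      linarith [le_max_left (‖W k ω‖ - R) 0]
    have h3 := pow_le_pow_left₀ (norm_nonneg _) h2 2
    show ‖W k ω‖ ^ 2 ≤ 2 * (max (‖W k ω‖ - R) 0) ^ 2 + 2 * R ^ 2
    nlinarith [sq_nonneg (max (‖W k ω‖ - R) 0 - R)]
  rw [integral_add ((hgInt k).const_mul 2) (integrable_const _), integral_const_mul] at h1
  have h2 : ∫ _ : Ω, 2 * R ^ 2 ∂μ = 2 * R ^ 2 := by simp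
  have h3 := hg k
  have h4 : 0 < R ^ 2 := by positivity
  linarith
end

section
/- Assume E[‖W_0‖₂²] < ∞ and let n ≥ 1 be an integer with T := nδ ≤ 1/(2L). Then E[‖W_n − W_0‖₂²] ≤ 16·(T²·L²·E[‖W_0‖₂²] + T·β²). -/
open MeasureTheory RealInnerProductSpace

lemma sgd_cross {d : ℕ} {Ω : Type*} [mΩ : MeasurableSpace Ω] (μ : Measure Ω) [IsProbabilityMeasure μ]
    (m : MeasurableSpace Ω) (hm : m ≤ mΩ) (X ξ : Ω → EuclideanSpace ℝ (Fin d))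
    (hX : StronglyMeasurable[m] X) (hX2 : MemLp X 2 μ) (hξ2 : MemLp ξ 2 μ)
    (hc : μ[ξ | m] =ᵐ[μ] fun _ => 0) :
    Integrable (fun ω => ⟪X ω, ξ ω⟫) μ ∧ ∫ ω, ⟪X ω, ξ ω⟫ ∂μ = 0 := by
  have hi : Integrable (fun ω => ⟪X ω, ξ ω⟫) μ := by
    refine Integrable.mono' ((hX2.integrable_norm_pow (p := 2) (by norm_num)).add
      (hξ2.integrable_norm_pow (p := 2) (by norm_num)))
      (hX2.aestronglyMeasurable.inner hξ2.aestronglyMeasurable) (ae_of_all _ fun ω => ?_)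
    have := norm_inner_le_norm (𝕜 := ℝ) (X ω) (ξ ω)
    simp only [Pi.add_apply]
    nlinarith [sq_nonneg (‖X ω‖ - ‖ξ ω‖), sq_nonneg (‖X ω‖ + ‖ξ ω‖)]
  refine ⟨hi, ?_⟩
  have h := condExp_bilin_of_stronglyMeasurable_left (innerSL ℝ (E := EuclideanSpace ℝ (Fin d)))
    (m := m) (μ := μ) (f := X) (g := ξ) hX hi (hξ2.integrable (by norm_num))
  rw [← integral_condExp hm]
  have h2 : μ[fun ω => ⟪X ω, ξ ω⟫ | m] =ᵐ[μ] fun _ => (0:ℝ) := by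
    refine Filter.EventuallyEq.trans h ?_
    filter_upwards [hc] with ω hω
    simp [hω]
  rw [integral_congr_ae h2]
  simp

lemma sgd_young (n : ℕ) (hn : 1 ≤ n) (a b : ℝ) :
    (a + b) ^ 2 ≤ (1 + 1 / (n:ℝ)) * a ^ 2 + (1 + n) * b ^ 2 := by
  have hn' : (0:ℝ) < n := by exact_mod_cast hn
  have : (1 + 1 / (n:ℝ)) * a ^ 2 + (1 + n) * b ^ 2 - (a + b) ^ 2 = (a - n * b) ^ 2 / n := by
    field_simp
    ring
  have h2 : 0 ≤ (a - n * b) ^ 2 / n := by positivity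
  linarith

lemma sgd_q (n : ℕ) (hn : 1 ≤ n) (L δ : ℝ) (hL : 0 < L) (hδ : 0 < δ)
    (hT : (n : ℝ) * δ ≤ 1 / (2 * L)) :
    ((1 + 1 / (n:ℝ)) * (1 + δ * L) ^ 2) ^ n ≤ 8 := by
  have hn' : (0:ℝ) < n := by exact_mod_cast hn
  have h0 : n * (δ * L) ≤ 1 / 2 := by
    have := (le_div_iff₀ (by positivity)).1 hT
    linarith
  have h1 : 1 + 1 / (n:ℝ) ≤ Real.exp (1 / n) := by
    rw [add_comm]; exact Real.add_one_le_exp _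
  have h2 : 1 + δ * L ≤ Real.exp (δ * L) := by
    rw [add_comm]; exact Real.add_one_le_exp _
  calc ((1 + 1 / (n:ℝ)) * (1 + δ * L) ^ 2) ^ n
      ≤ (Real.exp (1 / n) * Real.exp (δ * L) ^ 2) ^ n := by gcongr
    _ = Real.exp (1 + 2 * (n * (δ * L))) := by
        rw [← Real.exp_nat_mul, ← Real.exp_add, ← Real.exp_nat_mul]
        congr 1
        push_cast
        field_simp
    _ ≤ Real.exp (1 + 1) := by gcongr; linarith
    _ = Real.exp 1 * Real.exp 1 := Real.exp_add _ _
    _ ≤ 2.72 * 2.72 := by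
        have := Real.exp_one_lt_d9
        have : Real.exp 1 ≤ 2.72 := by linarith
        gcongr
    _ ≤ 8 := by norm_num

theorem sgd_divergence_bound {d : ℕ} (hd : 1 ≤ d)
    {Ω : Type*} [MeasurableSpace Ω] (μ : Measure Ω) [IsProbabilityMeasure μ]
    (U : EuclideanSpace ℝ (Fin d) → ℝ)
    (U' : EuclideanSpace ℝ (Fin d) → EuclideanSpace ℝ (Fin d))
    (hUgrad : ∀ x, HasGradientAt U (U' x) x)
    (hU'cont : Continuous U')
    (L m R β δ : ℝ) (hL : 0 < L) (hm : 0 < m) (hR : 0 < R) (hβ : 0 < β) (hδ : 0 < δ)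
    (hU'0 : U' 0 = 0)
    (hLip : ∀ x y, ‖U' x - U' y‖ ≤ L * ‖x - y‖)
    (hdiss : ∀ x y : EuclideanSpace ℝ (Fin d), R ≤ ‖x - y‖ →
      m * ‖x - y‖ ^ 2 ≤ ⟪U' x - U' y, x - y⟫)
    (W ξ : ℕ → Ω → EuclideanSpace ℝ (Fin d))
    (hWmeas : ∀ k, Measurable (W k)) (hξmeas : ∀ k, Measurable (ξ k))
    (hrec : ∀ k ω, W (k + 1) ω = W k ω - δ • U' (W k ω) + Real.sqrt δ • ξ k ω)
    (hξbound : ∀ k, ∀ᵐ ω ∂μ, ‖ξ k ω‖ ≤ β)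
    (hcond : ∀ k,
      μ[ξ k | MeasurableSpace.comap (W 0) inferInstance ⊔
          ⨆ i ∈ Finset.range k, MeasurableSpace.comap (ξ i) inferInstance]
        =ᵐ[μ] fun _ => 0)
    (hInt0 : Integrable (fun ω => ‖W 0 ω‖ ^ 2) μ)
    (n : ℕ) (hn : 1 ≤ n) (hT : (n : ℝ) * δ ≤ 1 / (2 * L)) :
    (∫ ω, ‖W n ω - W 0 ω‖ ^ 2 ∂μ) ≤
      16 * (((n : ℝ) * δ) ^ 2 * L ^ 2 * (∫ ω, ‖W 0 ω‖ ^ 2 ∂μ) + ((n : ℝ) * δ) * β ^ 2) := by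
  set F : ℕ → MeasurableSpace Ω := fun k => MeasurableSpace.comap (W 0) inferInstance ⊔
          ⨆ i ∈ Finset.range k, MeasurableSpace.comap (ξ i) inferInstance with hF
  have hFle : ∀ k, F k ≤ ‹MeasurableSpace Ω› := by
    intro k
    refine sup_le (hWmeas 0).comap_le (iSup₂_le fun i _ => (hξmeas i).comap_le)
  have hFmono : ∀ k, F k ≤ F (k + 1) := by
    intro k
    refine sup_le_sup le_rfl (iSup₂_le fun i hi => ?_)
    refine le_iSup₂_of_le (f := fun i (_ : i ∈ Finset.range (k+1)) =>
      MeasurableSpace.comap (ξ i) inferInstance) i ?_ le_rfl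
    simp only [Finset.mem_range] at hi ⊢
    omega
  have hξF : ∀ k, Measurable[F (k + 1)] (ξ k) := by
    intro k
    refine (comap_measurable (ξ k)).mono ?_ le_rfl
    refine le_sup_of_le_right ?_
    exact le_iSup₂_of_le (f := fun i (_ : i ∈ Finset.range (k+1)) =>
      MeasurableSpace.comap (ξ i) inferInstance) k (by simp) le_rfl
  have hW0F : ∀ k, Measurable[F k] (W 0) := by
    intro k
    exact (comap_measurable (W 0)).mono le_sup_left le_rfl
  have hWF : ∀ k, Measurable[F k] (W k) := by
    intro k
    induction k with
    | zero => exact hW0F 0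
    | succ k ih =>
      have h1 : Measurable[F (k + 1)] (W k) := ih.mono (hFmono k) le_rfl
      have h2 : W (k + 1) = fun ω => W k ω - δ • U' (W k ω) + Real.sqrt δ • ξ k ω :=
        funext (hrec k)
      rw [h2]
      exact (h1.sub ((hU'cont.measurable.comp h1).const_smul δ)).add ((hξF k).const_smul (Real.sqrt δ))
  have hU'le : ∀ x, ‖U' x‖ ≤ L * ‖x‖ := by
    intro x
    simpa [hU'0] using hLip x 0
  have hξ2 : ∀ k, MemLp (ξ k) 2 μ := fun k =>
    MemLp.of_bound (hξmeas k).aestronglyMeasurable β (hξbound k)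
  have hW2 : ∀ k, MemLp (W k) 2 μ ∧ MemLp (fun ω => U' (W k ω)) 2 μ := by
    have hstep : ∀ k, MemLp (W k) 2 μ → MemLp (fun ω => U' (W k ω)) 2 μ := by
      intro k h
      exact h.of_le_mul (hU'cont.measurable.comp (hWmeas k)).aestronglyMeasurable
        (ae_of_all _ fun ω => hU'le _)
    intro k
    induction k with
    | zero =>
      have := (memLp_two_iff_integrable_sq_norm (hWmeas 0).aestronglyMeasurable).2 hInt0
      exact ⟨this, hstep 0 this⟩
    | succ k ih =>
      have h2 : W (k + 1) = fun ω => W k ω - δ • U' (W k ω) + Real.sqrt δ • ξ k ω :=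
        funext (hrec k)
      have : MemLp (W (k + 1)) 2 μ := by
        rw [h2]
        exact (ih.1.sub (ih.2.const_smul δ)).add ((hξ2 k).const_smul (Real.sqrt δ))
      exact ⟨this, hstep _ this⟩
  set A : ℝ := ∫ ω, ‖W 0 ω‖ ^ 2 ∂μ with hA
  have hA0 : 0 ≤ A := integral_nonneg fun ω => by positivity
  have hn' : (1:ℝ) ≤ n := by exact_mod_cast hn
  set q : ℝ := (1 + 1 / (n:ℝ)) * (1 + δ * L) ^ 2 with hq
  set B : ℝ := (1 + n) * (δ * L) ^ 2 * A + δ * β ^ 2 with hB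
  have hB0 : 0 ≤ B := by positivity
  have hq1 : 1 ≤ q := by
    have h1 : 1 ≤ 1 + 1 / (n:ℝ) := by
      have : 0 ≤ 1 / (n:ℝ) := by positivity
      linarith
    have h2 : 1 ≤ (1 + δ * L) ^ 2 := by
      have : 0 < δ * L := by positivity
      nlinarith
    nlinarith
  have hstep : ∀ k, (∫ ω, ‖W (k + 1) ω - W 0 ω‖ ^ 2 ∂μ) ≤
      q * (∫ ω, ‖W k ω - W 0 ω‖ ^ 2 ∂μ) + B := by
    intro k
    set X : Ω → EuclideanSpace ℝ (Fin d) := fun ω => W k ω - W 0 ω - δ • U' (W k ω) with hX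
    have hD2 : MemLp (fun ω => W k ω - W 0 ω) 2 μ := (hW2 k).1.sub (hW2 0).1
    have hX2 : MemLp X 2 μ := hD2.sub ((hW2 k).2.const_smul δ)
    have hXm : Measurable[F k] X :=
      ((hWF k).sub (hW0F k)).sub ((hU'cont.measurable.comp (hWF k)).const_smul δ)
    obtain ⟨hci, hc0⟩ := sgd_cross μ (F k) (hFle k) X (ξ k) hXm.stronglyMeasurable hX2 (hξ2 k)
      (hcond k)
    have hDi : Integrable (fun ω => ‖W k ω - W 0 ω‖ ^ 2) μ :=
      hD2.integrable_norm_pow (p := 2) (by norm_num)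
    have hle : (∫ ω, ‖W (k + 1) ω - W 0 ω‖ ^ 2 ∂μ) ≤
        ∫ ω, (q * ‖W k ω - W 0 ω‖ ^ 2 + (1 + n) * (δ * L) ^ 2 * ‖W 0 ω‖ ^ 2 + δ * β ^ 2
          + 2 * Real.sqrt δ * ⟪X ω, ξ k ω⟫) ∂μ := by
      refine integral_mono_ae
        (((hW2 (k+1)).1.sub (hW2 0).1).integrable_norm_pow (p := 2) (by norm_num))
        ((((hDi.const_mul _).add (hInt0.const_mul _)).add (integrable_const _)).add
          (hci.const_mul _)) ?_
      filter_upwards [hξbound k] with ω hω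
      have e1 : W (k + 1) ω - W 0 ω = X ω + Real.sqrt δ • ξ k ω := by
        rw [hrec]; simp only [hX]; generalize δ • U' (W k ω) = y; abel
      have e2 : ‖W (k + 1) ω - W 0 ω‖ ^ 2 = ‖X ω‖ ^ 2 + 2 * Real.sqrt δ * ⟪X ω, ξ k ω⟫
          + δ * ‖ξ k ω‖ ^ 2 := by
        rw [e1, norm_add_sq_real, inner_smul_right, norm_smul, mul_pow, Real.norm_eq_abs, sq_abs,
          Real.sq_sqrt hδ.le]
        ring
      have e3 : ‖ξ k ω‖ ^ 2 ≤ β ^ 2 := by gcongr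
      have e4 : ‖X ω‖ ≤ (1 + δ * L) * ‖W k ω - W 0 ω‖ + δ * L * ‖W 0 ω‖ := by
        have f1 : ‖X ω‖ ≤ ‖W k ω - W 0 ω‖ + ‖δ • U' (W k ω)‖ := norm_sub_le _ _
        have f2 : ‖δ • U' (W k ω)‖ = δ * ‖U' (W k ω)‖ := by
          rw [norm_smul, Real.norm_eq_abs, abs_of_pos hδ]
        have f3 : ‖W k ω‖ ≤ ‖W k ω - W 0 ω‖ + ‖W 0 ω‖ := by
          simpa using norm_add_le (W k ω - W 0 ω) (W 0 ω)
        have f4 : δ * ‖U' (W k ω)‖ ≤ δ * (L * (‖W k ω - W 0 ω‖ + ‖W 0 ω‖)) := by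
          gcongr
          exact (hU'le _).trans (by gcongr)
        linarith
      have e5 : ‖X ω‖ ^ 2 ≤ q * ‖W k ω - W 0 ω‖ ^ 2 + (1 + n) * (δ * L) ^ 2 * ‖W 0 ω‖ ^ 2 := by
        have g1 := pow_le_pow_left₀ (norm_nonneg _) e4 2
        have g2 := sgd_young n hn ((1 + δ * L) * ‖W k ω - W 0 ω‖) (δ * L * ‖W 0 ω‖)
        refine g1.trans (g2.trans (le_of_eq ?_))
        rw [hq]; ring
      have e6 : δ * ‖ξ k ω‖ ^ 2 ≤ δ * β ^ 2 := by gcongr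
      change ‖W (k + 1) ω - W 0 ω‖ ^ 2 ≤ _
      rw [e2]
      linarith
    refine hle.trans (le_of_eq ?_)
    have i1 := hDi.const_mul q
    have i2 := hInt0.const_mul ((1 + n) * (δ * L) ^ 2)
    have i3 : Integrable (fun _ : Ω => δ * β ^ 2) μ := integrable_const _
    have i4 := hci.const_mul (2 * Real.sqrt δ)
    have i12 : Integrable (fun ω => q * ‖W k ω - W 0 ω‖ ^ 2
      + (1 + n) * (δ * L) ^ 2 * ‖W 0 ω‖ ^ 2) μ := i1.add i2
    have i123 : Integrable (fun ω => q * ‖W k ω - W 0 ω‖ ^ 2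
      + (1 + n) * (δ * L) ^ 2 * ‖W 0 ω‖ ^ 2 + δ * β ^ 2) μ := i12.add i3
    rw [integral_add i123 i4, integral_add i12 i3, integral_add i1 i2,
      integral_const_mul, integral_const_mul, integral_const_mul, integral_const_mul, hc0]
    simp [hB, hA]
    ring
  have hind : ∀ k : ℕ, (∫ ω, ‖W k ω - W 0 ω‖ ^ 2 ∂μ) ≤ q ^ k * (k * B) := by
    intro k
    induction k with
    | zero => simp
    | succ k ih =>
      have h1 : B ≤ q ^ (k + 1) * B := le_mul_of_one_le_left hB0 (one_le_pow₀ hq1)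
      have h2 := mul_le_mul_of_nonneg_left ih (zero_le_one.trans hq1)
      refine (hstep k).trans ?_
      push_cast
      have : q ^ (k + 1) * ((k + 1) * B) = q * (q ^ k * (k * B)) + q ^ (k + 1) * B := by ring
      linarith
  have hq8 : q ^ n ≤ 8 := sgd_q n hn L δ hL hδ hT
  have hnB : 0 ≤ n * B := by positivity
  calc (∫ ω, ‖W n ω - W 0 ω‖ ^ 2 ∂μ) ≤ q ^ n * (n * B) := hind n
    _ ≤ 8 * (n * B) := by gcongr
    _ ≤ _ := by
      have h1 : (1 + (n:ℝ)) * (n * (δ * L) ^ 2 * A) ≤ (2 * n) * (n * (δ * L) ^ 2 * A) := by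
        gcongr; linarith
      have h2 : 0 ≤ n * (δ * β ^ 2) := by positivity
      rw [hB]
      nlinarith
end

section
/- For every integer n ≥ 1, setting T := nδ, one has E[‖V_n − V_0‖₂²] ≤ T²·L²·E[‖V_0‖₂²] + T·β². -/
open MeasureTheory RealInnerProductSpace

/-- If `X` is `m`-measurable and `E[Z | m] = 0`, then `E⟪X, Z⟫ = 0`. -/
theorem integral_inner_eq_zero_aux {E : Type*} [NormedAddCommGroup E] [InnerProductSpace ℝ E]
    [CompleteSpace E] {Ω : Type*} {m mΩ : MeasurableSpace Ω} (μ : Measure Ω)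
    [IsProbabilityMeasure μ] (hle : m ≤ mΩ) (X Z : Ω → E)
    (hX : StronglyMeasurable[m] X) (hXZ : Integrable (fun ω => inner ℝ (X ω) (Z ω)) μ)
    (hZ : Integrable Z μ) (hk : μ[Z | m] =ᵐ[μ] fun _ => 0) :
    ∫ ω, inner ℝ (X ω) (Z ω) ∂μ = 0 := by
  have h : μ[fun ω => inner ℝ (X ω) (Z ω) | m] =ᵐ[μ] fun ω => inner ℝ (X ω) (μ[Z | m] ω) :=
    condExp_bilin_of_stronglyMeasurable_left (m := m) (μ := μ) (innerSL ℝ) hX hXZ hZ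
  rw [← integral_condExp hle, integral_congr_ae h]
  have : (fun ω => inner ℝ (X ω) ((μ[Z | m]) ω)) =ᵐ[μ] fun _ => (0 : ℝ) := by
    filter_upwards [hk] with ω hω
    rw [hω, inner_zero_right]
  rw [integral_congr_ae this]
  simp

theorem frozen_process_divergence_bound {d : ℕ} (hd : 1 ≤ d)
    {Ω : Type*} [MeasurableSpace Ω] (μ : Measure Ω) [IsProbabilityMeasure μ]
    (U : EuclideanSpace ℝ (Fin d) → ℝ)
    (U' : EuclideanSpace ℝ (Fin d) → EuclideanSpace ℝ (Fin d))
    (hUgrad : ∀ x, HasGradientAt U (U' x) x)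
    (hU'cont : Continuous U')
    (L β δ : ℝ) (hL : 0 < L) (hβ : 0 < β) (hδ : 0 < δ)
    (hU'0 : U' 0 = 0)
    (hLip : ∀ x y, ‖U' x - U' y‖ ≤ L * ‖x - y‖)
    (V ζ : ℕ → Ω → EuclideanSpace ℝ (Fin d))
    (hVmeas : Measurable (V 0)) (hζmeas : ∀ k, Measurable (ζ k))
    (hInt0 : Integrable (fun ω => ‖V 0 ω‖ ^ 2) μ)
    (hζbound : ∀ k, ∀ᵐ ω ∂μ, ‖ζ k ω‖ ≤ β)
    (hcond : ∀ k,
      μ[ζ k | MeasurableSpace.comap (V 0) inferInstance ⊔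
          ⨆ i ∈ Finset.range k, MeasurableSpace.comap (ζ i) inferInstance]
        =ᵐ[μ] fun _ => 0)
    (hrec : ∀ k ω, V (k + 1) ω = V k ω - δ • U' (V 0 ω) + Real.sqrt δ • ζ k ω)
    (n : ℕ) (hn : 1 ≤ n) :
    (∫ ω, ‖V n ω - V 0 ω‖ ^ 2 ∂μ) ≤
      ((n : ℝ) * δ) ^ 2 * L ^ 2 * (∫ ω, ‖V 0 ω‖ ^ 2 ∂μ) + ((n : ℝ) * δ) * β ^ 2 := by
  classical
  set a : ℝ := -((n : ℝ) * δ) with ha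
  set c : ℝ := Real.sqrt δ with hc
  have hc2 : c ^ 2 = δ := Real.sq_sqrt hδ.le
  -- closed form of the recursion
  have hV : ∀ k ω, V k ω - V 0 ω
      = (-((k : ℝ) * δ)) • U' (V 0 ω) + c • ∑ i ∈ Finset.range k, ζ i ω := by
    intro k ω
    induction k with
    | zero => simp
    | succ k ih =>
      rw [hrec, Finset.sum_range_succ]
      have : V k ω = V 0 ω + ((-((k : ℝ) * δ)) • U' (V 0 ω)
          + c • ∑ i ∈ Finset.range k, ζ i ω) := by rw [← ih]; abel
      rw [this]
      push_cast
      module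
  have hG : ∀ x, ‖U' x‖ ≤ L * ‖x‖ := by
    intro x
    simpa [hU'0] using hLip x 0
  let W : ℕ → Ω → EuclideanSpace ℝ (Fin d) :=
    fun k ω => a • U' (V 0 ω) + c • ∑ i ∈ Finset.range k, ζ i ω
  have hW1 : ∀ k ω, W (k + 1) ω = W k ω + c • ζ k ω := by
    intro k ω
    simp only [W, Finset.sum_range_succ, smul_add, add_assoc]
  have hGm : Measurable fun ω => U' (V 0 ω) := hU'cont.measurable.comp hVmeas
  have hVL : MemLp (V 0) 2 μ :=
    (memLp_two_iff_integrable_sq_norm hVmeas.aestronglyMeasurable).2 hInt0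
  have hGL : MemLp (fun ω => U' (V 0 ω)) 2 μ :=
    hVL.of_le_mul hGm.aestronglyMeasurable (Filter.Eventually.of_forall fun ω => hG _)
  have hζL : ∀ k, MemLp (ζ k) 2 μ := fun k =>
    MemLp.of_bound (hζmeas k).aestronglyMeasurable β (hζbound k)
  have hWL : ∀ k, MemLp (W k) 2 μ := by
    intro k
    induction k with
    | zero =>
      have : W 0 = a • fun ω => U' (V 0 ω) := by funext ω; simp [W]
      rw [this]
      exact hGL.const_smul a
    | succ k ih =>
      have : W (k + 1) = W k + c • ζ k := funext fun ω => hW1 k ω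
      rw [this]
      exact ih.add ((hζL k).const_smul c)
  have hWint : ∀ k, Integrable (fun ω => ‖W k ω‖ ^ 2) μ := fun k =>
    (memLp_two_iff_integrable_sq_norm (hWL k).1).1 (hWL k)
  have hin : ∀ k, Integrable (fun ω => inner ℝ (W k ω) (ζ k ω)) μ := by
    intro k
    refine Integrable.mono' (((hWL k).integrable (by norm_num)).norm.mul_const β)
      ((hWL k).1.inner (hζL k).1) ?_
    filter_upwards [hζbound k] with ω hω
    exact (norm_inner_le_norm _ _).trans (mul_le_mul_of_nonneg_left hω (norm_nonneg _))
  have horth : ∀ k, ∫ ω, inner ℝ (W k ω) (ζ k ω) ∂μ = 0 := by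
    intro k
    have hk := hcond k
    have hle := sup_le hVmeas.comap_le
      (iSup₂_le fun i (_ : i ∈ Finset.range k) => (hζmeas i).comap_le)
    let m : MeasurableSpace Ω := MeasurableSpace.comap (V 0) inferInstance ⊔
          ⨆ i ∈ Finset.range k, MeasurableSpace.comap (ζ i) inferInstance
    have h0 : Measurable[m] (V 0) :=
      (comap_measurable (V 0)).mono le_sup_left le_rfl
    have hi : ∀ i ∈ Finset.range k, Measurable[m] (ζ i) := fun i hi =>
      (comap_measurable (ζ i)).mono
        ((le_iSup₂ (f := fun i (_ : i ∈ Finset.range k) =>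
          MeasurableSpace.comap (ζ i) inferInstance) i hi).trans le_sup_right) le_rfl
    have hWm : Measurable[m] (W k) :=
      ((hU'cont.measurable.comp h0).const_smul a).add
        ((Finset.measurable_fun_sum _ hi).const_smul c)
    exact integral_inner_eq_zero_aux μ hle (W k) (ζ k) hWm.stronglyMeasurable (hin k)
      ((hζL k).integrable (by norm_num)) hk
  have key : ∀ k : ℕ, ∫ ω, ‖W k ω‖ ^ 2 ∂μ ≤
      a ^ 2 * L ^ 2 * (∫ ω, ‖V 0 ω‖ ^ 2 ∂μ) + ((k : ℝ) * δ) * β ^ 2 := by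
    intro k
    induction k with
    | zero =>
      rw [← integral_const_mul]
      simp only [Nat.cast_zero, zero_mul, add_zero]
      refine integral_mono (hWint 0) (hInt0.const_mul _) fun ω => ?_
      simp only [W, Finset.range_zero, Finset.sum_empty, smul_zero, add_zero, norm_smul, mul_pow,
        Real.norm_eq_abs, sq_abs]
      rw [mul_assoc, ← mul_pow L]
      exact mul_le_mul_of_nonneg_left (pow_le_pow_left₀ (norm_nonneg _) (hG (V 0 ω)) 2)
        (sq_nonneg a)
    | succ k ih =>
      have hb : ∫ ω, ‖W (k + 1) ω‖ ^ 2 ∂μ ≤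
          ∫ ω, (‖W k ω‖ ^ 2 + (2 * c) * inner ℝ (W k ω) (ζ k ω) + δ * β ^ 2) ∂μ := by
        refine integral_mono_ae (hWint _)
          (((hWint k).add ((hin k).const_mul _)).add (integrable_const _)) ?_
        filter_upwards [hζbound k] with ω hω
        rw [hW1, norm_add_sq_real, real_inner_smul_right, norm_smul, mul_pow, Real.norm_eq_abs,
          sq_abs, hc2]
        have : δ * ‖ζ k ω‖ ^ 2 ≤ δ * β ^ 2 := by gcongr
        linarith
      have hadd : Integrable (fun ω => ‖W k ω‖ ^ 2 + (2 * c) * inner ℝ (W k ω) (ζ k ω)) μ :=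
        (hWint k).add ((hin k).const_mul _)
      rw [integral_add hadd (integrable_const _),
        integral_add (hWint k) ((hin k).const_mul _), integral_const_mul, horth k] at hb
      simp at hb
      push_cast
      linarith
  have hfin := key n
  simp only [ha, neg_sq] at hfin
  refine le_trans (le_of_eq ?_) hfin
  simp only [hV, W, ha]
end
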